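/- arXiv:2004.03550 — 3 statements merged into one kernel-verified Lean document; each statement's English description precedes it below -/
import Mathlib

section
/- Let i ≠ j ∈ {1,...,6} with i + j ≢ 0 (mod 7). Then there is no homeomorphism h of ℂℙ² onto itself such that h maps the line L_k of the arrangement N_i onto the line L_k of the arrangement N_j for every k ∈ {1,...,11}; that is, N_i and N_j form an ordered Zariski pair. -/
/- The complex projective plane `ℂℙ²`, with its quotient topology, and projective
lines given as zero loci of linear forms in the homogeneous coordinates. -/

open scoped LinearAlgebra.Projectivization
open Projectivization

noncomputable section

abbrev CP2 := ℙ ℂ (Fin 3 → ℂ)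

instance : TopologicalSpace CP2 :=
  inferInstanceAs (TopologicalSpace (Quotient (projectivizationSetoid ℂ (Fin 3 → ℂ))))

/-- The projective line `{[x:y:z] | a*x + b*y + c*z = 0}`.  (The zero locus of a linear
form is well defined on any representative, so we may use the representative `p.rep`.) -/
def projLine (a b c : ℂ) : Set CP2 :=
  {p | a * p.rep 0 + b * p.rep 1 + c * p.rep 2 = 0}

/-- The lines of the arrangement `N_i`, where `α = ξ^i`:
`L1: z=0`, `L2: αx−y+z=0`, `L3: (α²+α)x−αy+(α+1)z=0`, `L4: x=0`, `L5: x+αy−(α+1)z=0`,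
`L6: (α+1)x−y=0`, `L7: x−z=0`, `L8: αx+α²y−(α³+α²+α)z=0`, `L9: y=0`, `L10: y−z=0`,
`L11: (α²+1)y−(α²+α+1)z=0`. -/
def Nline (α : ℂ) : Fin 11 → Set CP2 :=
  ![projLine 0 0 1,
    projLine α (-1) 1,
    projLine (α^2 + α) (-α) (α + 1),
    projLine 1 0 0,
    projLine 1 α (-(α + 1)),
    projLine (α + 1) (-1) 0,
    projLine 1 0 (-1),
    projLine α (α^2) (-(α^3 + α^2 + α)),
    projLine 0 1 0,
    projLine 0 1 (-1),
    projLine 0 (α^2 + 1) (-(α^2 + α + 1))]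

open Complex in
theorem exp_const {X : Type*} [TopologicalSpace X] {s : Set X} (hs : IsPreconnected s)
    {f : X → ℂ} (hf : ContinuousOn f s)
    (he : ∀ a ∈ s, ∀ b ∈ s, Complex.exp (f a) = Complex.exp (f b)) {a b : X} (ha : a ∈ s)
    (hb : b ∈ s) : f a = f b :=
  Complex.isCoveringMap_exp.constOn_of_comp hs hf
    (fun a ha b hb => Subtype.ext (he a ha b hb)) ha hb

abbrev W3 := Fin 3 → ℂ

def ev (a v : W3) : ℂ := a 0 * v 0 + a 1 * v 1 + a 2 * v 2

theorem ev_smul (a v : W3) (c : ℂ) : ev a (c • v) = c * ev a v := by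
  simp [ev]; ring

theorem ev_add (a v w : W3) : ev a (v + w) = ev a v + ev a w := by
  simp [ev]; ring

theorem ev_zero (a : W3) : ev a 0 = 0 := by simp [ev]

theorem ev_cont (a : W3) : Continuous (ev a) := by
  unfold ev; fun_prop

theorem ne_of_ev {a v : W3} (h : ev a v ≠ 0) : v ≠ 0 := by
  rintro rfl; exact h (ev_zero a)

theorem e0_ne : (![1, 0, 0] : W3) ≠ 0 := fun h => by simpa using congrFun h 0

open Classical in
def pt (v : W3) : CP2 := if h : v ≠ 0 then mk ℂ v h else mk ℂ ![1, 0, 0] e0_ne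

theorem pt_of {v : W3} (h : v ≠ 0) : pt v = mk ℂ v h := by simp [pt, h]

theorem pt_rep (p : CP2) : pt p.rep = p := by
  rw [pt_of p.rep_nonzero, mk_rep]

theorem ev_pt {v : W3} (h : v ≠ 0) : ∃ c : ℂ, c ≠ 0 ∧ ∀ a, ev a (pt v).rep = c * ev a v := by
  rw [pt_of h]
  obtain ⟨u, hu⟩ := exists_smul_eq_mk_rep ℂ v h
  refine ⟨u, u.ne_zero, fun a => ?_⟩
  rw [← hu]; exact ev_smul a v u

theorem ev_pt_ne {v : W3} (h : v ≠ 0) (a : W3) : ev a (pt v).rep ≠ 0 ↔ ev a v ≠ 0 := by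
  obtain ⟨c, hc, H⟩ := ev_pt h
  simp [H, hc]

theorem ev_pt_zero {v : W3} (h : v ≠ 0) (a : W3) : ev a (pt v).rep = 0 ↔ ev a v = 0 := by
  obtain ⟨c, hc, H⟩ := ev_pt h
  simp [H, hc]

theorem rat_pt {v : W3} (h : v ≠ 0) (a b : W3) :
    ev a (pt v).rep / ev b (pt v).rep = ev a v / ev b v := by
  obtain ⟨c, hc, H⟩ := ev_pt h
  rw [H, H, mul_div_mul_left _ _ hc]

theorem pt_smul {v : W3} (h : v ≠ 0) {c : ℂ} (hc : c ≠ 0) : pt (c • v) = pt v := by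
  have : c • v ≠ 0 := smul_ne_zero hc h
  rw [pt_of h, pt_of this, mk_eq_mk_iff']
  exact ⟨c, rfl⟩

theorem mkq : Topology.IsQuotientMap (fun v : {v : W3 // v ≠ 0} => (pt v.1 : CP2)) := by
  have : (fun v : {v : W3 // v ≠ 0} => (pt v.1 : CP2)) =
      (Quotient.mk _ : {v : W3 // v ≠ 0} → Quotient (projectivizationSetoid ℂ (Fin 3 → ℂ))) := by
    funext v; rw [pt_of v.2]; rfl
  rw [this]
  exact isQuotientMap_quotient_mk'

theorem cont_pt : ContinuousOn pt {v : W3 | v ≠ 0} := by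
  rw [continuousOn_iff_continuous_domRestrict]
  exact mkq.continuous

theorem isOpen_ev (a : W3) : IsOpen {p : CP2 | ev a p.rep ≠ 0} := by
  rw [← mkq.isOpen_preimage]
  have : (fun v : {v : W3 // v ≠ 0} => (pt v.1 : CP2)) ⁻¹' {p : CP2 | ev a p.rep ≠ 0} =
      {v | ev a v.1 ≠ 0} := by
    ext v; exact ev_pt_ne v.2 a
  rw [this]
  exact isOpen_ne_fun ((ev_cont a).comp continuous_subtype_val) continuous_const

theorem cont_rat (a b : W3) :
    ContinuousOn (fun p : CP2 => ev a p.rep / ev b p.rep) {p : CP2 | ev b p.rep ≠ 0} := by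
  rw [mkq.continuousOn_isOpen_iff (isOpen_ev b)]
  have : ((fun p : CP2 => ev a p.rep / ev b p.rep) ∘ fun v : {v : W3 // v ≠ 0} => (pt v.1 : CP2)) =
     fun v => ev a v.1 / ev b v.1 := by
    funext v; exact rat_pt v.2 a b
  rw [this]
  refine ContinuousOn.div ((ev_cont a).comp continuous_subtype_val).continuousOn
    ((ev_cont b).comp continuous_subtype_val).continuousOn ?_
  intro v hv
  exact (ev_pt_ne v.2 b).1 hv
def cr (a b : W3) : W3 := ![a 1 * b 2 - a 2 * b 1, a 2 * b 0 - a 0 * b 2, a 0 * b 1 - a 1 * b 0]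

theorem exists_dual (a b : W3) (hab : cr a b ≠ 0) : ∃ c ea eb ec : W3,
    (∀ x y z : ℂ, ev a (x • ea + y • eb + z • ec) = x ∧ ev b (x • ea + y • eb + z • ec) = y ∧
      ev c (x • ea + y • eb + z • ec) = z) ∧
    ∀ v, ev a v • ea + ev b v • eb + ev c v • ec = v := by
  obtain ⟨c, hc⟩ : ∃ c : W3, ev c (cr a b) ≠ 0 := by
    by_contra! h
    apply hab
    funext i
    fin_cases i
    · simpa [ev] using h ![1, 0, 0]
    · simpa [ev] using h ![0, 1, 0]
    · simpa [ev] using h ![0, 0, 1]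
  set D := ev c (cr a b) with hD
  have hD' : D = c 0 * (a 1 * b 2 - a 2 * b 1) + c 1 * (a 2 * b 0 - a 0 * b 2)
      + c 2 * (a 0 * b 1 - a 1 * b 0) := by
    rw [hD]; simp [ev, cr]
  clear_value D
  refine ⟨c, D⁻¹ • cr b c, D⁻¹ • cr c a, D⁻¹ • cr a b, ?_, ?_⟩
  · intro x y z
    refine ⟨?_, ?_, ?_⟩
    all_goals
      apply mul_left_cancel₀ hc
      simp [ev, cr, hc]
      field_simp
      rw [hD']; ring
  · intro v
    funext i
    apply mul_left_cancel₀ hc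
    fin_cases i
    all_goals
      simp [ev, cr, hc]
      field_simp
      rw [hD']; ring

/-- continuous logarithm on the plane -/
theorem exists_log2 (F : ℂ × ℂ → ℂ) (hF : Continuous F) (h0 : ∀ x, F x ≠ 0) :
    ∃ f : ℂ × ℂ → ℂ, Continuous f ∧ ∀ x, Complex.exp (f x) = F x := by
  obtain ⟨f, ⟨-, hf⟩, -⟩ := Complex.isCoveringMapOn_exp.existsUnique_continuousMap_lifts
    (⟨F, hF⟩ : C(ℂ × ℂ, ℂ)) (a₀ := (0, 0)) (e₀ := Complex.log (F (0, 0)))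
    (Complex.exp_log (h0 _)) (fun x => h0 x)
  exact ⟨f, f.continuous, fun x => congrFun hf x⟩

theorem lemA (a b : W3) (hab : cr a b ≠ 0) (F : CP2 → ℂ)
    (hF : ContinuousOn F {p | ev a p.rep ≠ 0 ∧ ev b p.rep ≠ 0})
    (h0 : ∀ p : CP2, ev a p.rep ≠ 0 → ev b p.rep ≠ 0 → F p ≠ 0) :
    ∃ (m : ℤ) (φ : CP2 → ℂ), ContinuousOn φ {p | ev a p.rep ≠ 0 ∧ ev b p.rep ≠ 0} ∧
      ∀ p : CP2, ev a p.rep ≠ 0 → ev b p.rep ≠ 0 →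
        F p = (ev a p.rep / ev b p.rep) ^ m * Complex.exp (φ p) := by
  obtain ⟨c, ea, eb, ec, hd, hv⟩ := exists_dual a b hab
  set g : ℂ × ℂ → W3 := fun x => Complex.exp x.1 • ea + (1 : ℂ) • eb + x.2 • ec with hg
  have hgc : Continuous g := by rw [hg]; fun_prop
  have ha : ∀ x, ev a (g x) = Complex.exp x.1 := fun x => (hd _ _ _).1
  have hb : ∀ x, ev b (g x) = 1 := fun x => (hd _ _ _).2.1
  have hgn : ∀ x, g x ≠ 0 := fun x => ne_of_ev (a := b) (by rw [hb]; exact one_ne_zero)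
  have hgU : ∀ x, ev a (pt (g x)).rep ≠ 0 ∧ ev b (pt (g x)).rep ≠ 0 := fun x => by
    rw [ev_pt_ne (hgn x), ev_pt_ne (hgn x), ha, hb]
    exact ⟨Complex.exp_ne_zero _, one_ne_zero⟩
  have hptc : Continuous (fun x => pt (g x)) := cont_pt.comp_continuous hgc hgn
  obtain ⟨ψ, hψc, hψ⟩ := exists_log2 (fun x => F (pt (g x)))
    (hF.comp_continuous hptc hgU) (fun x => h0 _ (hgU x).1 (hgU x).2)
  have hper : ∀ x y : ℂ × ℂ, ψ (x.1 + 2 * Real.pi * Complex.I, x.2) - ψ x =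
      ψ (y.1 + 2 * Real.pi * Complex.I, y.2) - ψ y := by
    intro x y
    refine exp_const (s := Set.univ) (f := fun x : ℂ × ℂ =>
      ψ (x.1 + 2 * Real.pi * Complex.I, x.2) - ψ x) isPreconnected_univ
      (Continuous.continuousOn (by fun_prop)) ?_ (Set.mem_univ _) (Set.mem_univ _)
    have : ∀ x : ℂ × ℂ, Complex.exp (ψ (x.1 + 2 * Real.pi * Complex.I, x.2) - ψ x) = 1 := by
      intro x
      rw [Complex.exp_sub, hψ, hψ]
      have : g (x.1 + 2 * Real.pi * Complex.I, x.2) = g x := by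
        simp [hg, Complex.exp_add]
      rw [this, div_self (h0 _ (hgU x).1 (hgU x).2)]
    intro a _ b _
    rw [this, this]
  obtain ⟨m, hm⟩ : ∃ m : ℤ, ∀ x : ℂ × ℂ, ψ (x.1 + 2 * Real.pi * Complex.I, x.2) - ψ x =
      m * (2 * Real.pi * Complex.I) := by
    have : Complex.exp (ψ ((0 : ℂ × ℂ).1 + 2 * Real.pi * Complex.I, (0 : ℂ × ℂ).2) - ψ 0) = 1 := by
      rw [Complex.exp_sub, hψ, hψ]
      have : g ((0 : ℂ × ℂ).1 + 2 * Real.pi * Complex.I, (0 : ℂ × ℂ).2) = g 0 := by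
        simp [hg]
      rw [this, div_self (h0 _ (hgU 0).1 (hgU 0).2)]
    obtain ⟨m, hm⟩ := Complex.exp_eq_one_iff.1 this
    exact ⟨m, fun x => by rw [hper x 0, hm]⟩
  set χ : ℂ × ℂ → ℂ := fun x => ψ x - m * x.1 with hχ
  have hχc : Continuous χ := by rw [hχ]; fun_prop
  have hχ1 : ∀ w y, χ (w + 2 * Real.pi * Complex.I, y) = χ (w, y) := by
    intro w y
    have := hm (w, y)
    simp only [hχ] at this ⊢
    linear_combination this
  have hχn : ∀ (n : ℤ) w y, χ (w + n * (2 * Real.pi * Complex.I), y) = χ (w, y) := by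
    intro n
    induction n using Int.induction_on with
    | zero => simp
    | succ n ih =>
      intro w y
      rw [← ih w y, ← hχ1 (w + (n : ℤ) * (2 * Real.pi * Complex.I)) y]; congr 2; push_cast; ring
    | pred n ih =>
      intro w y
      rw [← ih w y, ← hχ1 _ y]; congr 2; push_cast; ring
  have hχe : ∀ w w' y, Complex.exp w = Complex.exp w' → χ (w, y) = χ (w', y) := by
    intro w w' y h
    obtain ⟨n, hn⟩ := Complex.exp_eq_exp_iff_exists_int.1 h
    rw [hn, hχn]
  refine ⟨m, fun p => χ (Complex.log (ev a p.rep / ev b p.rep), ev c p.rep / ev b p.rep), ?_, ?_⟩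
  · intro p hp
    have hop : IsOpen {p : CP2 | ev a p.rep ≠ 0 ∧ ev b p.rep ≠ 0} :=
      (isOpen_ev a).inter (isOpen_ev b)
    have h1 : ContinuousAt (fun p : CP2 => ev a p.rep / ev b p.rep) p :=
      (cont_rat a b).continuousAt ((isOpen_ev b).mem_nhds hp.2)
    have h2 : ContinuousAt (fun p : CP2 => ev c p.rep / ev b p.rep) p :=
      (cont_rat c b).continuousAt ((isOpen_ev b).mem_nhds hp.2)
    have hne : ev a p.rep / ev b p.rep ≠ 0 := div_ne_zero hp.1 hp.2
    apply ContinuousAt.continuousWithinAt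
    by_cases hs : ev a p.rep / ev b p.rep ∈ Complex.slitPlane
    · exact hχc.continuousAt.comp ((h1.clog hs).prodMk h2)
    · have hs' : -(ev a p.rep / ev b p.rep) ∈ Complex.slitPlane := by
        rw [Complex.mem_slitPlane_iff] at hs ⊢
        push Not at hs
        left
        simp only [Complex.neg_re, Left.neg_pos_iff]
        refine lt_of_le_of_ne hs.1 fun h => hne (Complex.ext h hs.2)
      have h3 : ContinuousAt (fun p : CP2 => χ (Complex.log (-(ev a p.rep / ev b p.rep))
          + Real.pi * Complex.I, ev c p.rep / ev b p.rep)) p :=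
        hχc.continuousAt.comp ((((h1.neg).clog hs').add continuousAt_const).prodMk h2)
      refine h3.congr ?_
      filter_upwards [hop.mem_nhds hp] with q hq
      have hq' : ev a q.rep / ev b q.rep ≠ 0 := div_ne_zero hq.1 hq.2
      apply hχe
      rw [Complex.exp_add, Complex.exp_pi_mul_I, Complex.exp_log hq', Complex.exp_log (neg_ne_zero.2 hq')]
      ring
  · intro p hpa hpb
    have hne : ev a p.rep / ev b p.rep ≠ 0 := div_ne_zero hpa hpb
    simp only [hχ]
    rw [Complex.exp_sub, hψ, Complex.exp_int_mul, Complex.exp_log hne,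
      mul_div_cancel₀ _ (zpow_ne_zero _ hne)]
    congr 1
    have : g (Complex.log (ev a p.rep / ev b p.rep), ev c p.rep / ev b p.rep) =
        (ev b p.rep)⁻¹ • p.rep := by
      conv_rhs => enter [2]; rw [← hv p.rep]
      simp only [hg, Complex.exp_log hne, smul_add, smul_smul]
      rw [inv_mul_cancel₀ hpb, inv_mul_eq_div, inv_mul_eq_div]
    rw [this, pt_smul p.rep_nonzero (inv_ne_zero hpb), pt_rep]
theorem lemL (a b c : W3) (hab : cr a b ≠ 0) (hac : cr a c ≠ 0) (n₁ n₂ n₃ : ℤ) (φ : CP2 → ℂ)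
    (hφ : ContinuousOn φ {p | ev a p.rep ≠ 0 ∧ ev b p.rep ≠ 0 ∧ ev c p.rep ≠ 0})
    (h : ∀ v, ev a v ≠ 0 → ev b v ≠ 0 → ev c v ≠ 0 →
      ev a v ^ n₁ * ev b v ^ n₂ * ev c v ^ n₃ = Complex.exp (φ (pt v))) : n₁ = 0 := by
  obtain ⟨_, ea, eb, _, hd, -⟩ := exists_dual a b hab
  obtain ⟨_, _, ec, _, hd', -⟩ := exists_dual a c hac
  have h1 : ev a ea = 1 := by simpa using (hd 1 0 0).1
  have h2 : ev a eb = 0 := by simpa using (hd 0 1 0).1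
  have h3 : ev b eb = 1 := by simpa using (hd 0 1 0).2.1
  have h4 : ev a ec = 0 := by simpa using (hd' 0 1 0).1
  have h5 : ev c ec = 1 := by simpa using (hd' 0 1 0).2.1
  obtain ⟨v₀, hv0, hvb, hvc⟩ : ∃ v₀, ev a v₀ = 0 ∧ ev b v₀ ≠ 0 ∧ ev c v₀ ≠ 0 := by
    by_cases e1 : ev c eb = 0
    · by_cases e2 : ev b ec = 0
      · exact ⟨eb + ec, by simp [ev_add, *], by simp [ev_add, *], by simp [ev_add, *]⟩
      · exact ⟨ec, h4, e2, by simp [h5]⟩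
    · exact ⟨eb, h2, by simp [h3], e1⟩
  set v : ℂ → W3 := fun z => v₀ + z • ea with hv
  have hvcont : Continuous v := by rw [hv]; fun_prop
  have hva : ∀ z, ev a (v z) = z := fun z => by simp [hv, ev_add, ev_smul, hv0, h1]
  have hv00 : v 0 = v₀ := by simp [hv]
  set g : ℂ → ℂ := fun z => (ev b (v z) / ev b v₀) ^ n₂ * (ev c (v z) / ev c v₀) ^ n₃ with hg
  have cb : Continuous fun z => ev b (v z) := (ev_cont b).comp hvcont
  have cc : Continuous fun z => ev c (v z) := (ev_cont c).comp hvcont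
  have hgat : ∀ z, ev b (v z) ≠ 0 → ev c (v z) ≠ 0 → ContinuousAt g z := by
    intro z hz1 hz2
    refine ContinuousAt.mul ?_ ?_
    · exact (cb.continuousAt.div_const _).zpow₀ _ (Or.inl (div_ne_zero hz1 hvb))
    · exact (cc.continuousAt.div_const _).zpow₀ _ (Or.inl (div_ne_zero hz2 hvc))
  have hg0 : g 0 = 1 := by simp [hg, hv00, div_self hvb, div_self hvc]
  have hev : ∀ᶠ z in nhds (0 : ℂ), ev b (v z) ≠ 0 ∧ ev c (v z) ≠ 0 ∧ 0 < (g z).re := by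
    have i1 := cb.continuousAt.eventually_ne (x := 0) (by rw [hv00]; exact hvb)
    have i2 := cc.continuousAt.eventually_ne (x := 0) (by rw [hv00]; exact hvc)
    have i3 : ContinuousAt (fun z => (g z).re) 0 :=
      Complex.continuous_re.continuousAt.comp
        (hgat 0 (by rw [hv00]; exact hvb) (by rw [hv00]; exact hvc))
    have i4 := i3.eventually (lt_mem_nhds (a := 0) (by simp [hg0]))
    filter_upwards [i1, i2, i4] with z j1 j2 j3 using ⟨j1, j2, j3⟩
  obtain ⟨r, hr, hball⟩ := Metric.eventually_nhds_iff.1 hev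
  set z : ℝ → ℂ := fun θ => (r / 2 : ℝ) * Complex.exp (θ * Complex.I) with hz
  have hzc : Continuous z := by rw [hz]; fun_prop
  have hr0 : ((r / 2 : ℝ) : ℂ) ≠ 0 := by
    exact_mod_cast (half_pos hr).ne'
  have hz0 : ∀ θ, z θ ≠ 0 := fun θ => mul_ne_zero hr0 (Complex.exp_ne_zero _)
  have hzb : ∀ θ, dist (z θ) 0 < r := by
    intro θ
    rw [dist_zero_right, hz]
    simp only [norm_mul, Complex.norm_exp_ofReal_mul_I, Complex.norm_real, mul_one, Real.norm_eq_abs]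
    rw [abs_of_pos (half_pos hr)]; linarith
  have hzz := fun θ => hball (hzb θ)
  have hvn : ∀ θ, v (z θ) ≠ 0 := fun θ => ne_of_ev (hzz θ).1
  have hpU : ∀ θ, pt (v (z θ)) ∈ {p : CP2 | ev a p.rep ≠ 0 ∧ ev b p.rep ≠ 0 ∧ ev c p.rep ≠ 0} := by
    intro θ
    refine ⟨?_, ?_, ?_⟩
    · rw [ev_pt_ne (hvn θ), hva]; exact hz0 θ
    · rw [ev_pt_ne (hvn θ)]; exact (hzz θ).1
    · rw [ev_pt_ne (hvn θ)]; exact (hzz θ).2.1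
  have c1 : Continuous fun θ => φ (pt (v (z θ))) :=
    hφ.comp_continuous (cont_pt.comp_continuous (hvcont.comp hzc) hvn) hpU
  have c2 : Continuous fun θ => Complex.log (g (z θ)) := by
    rw [continuous_iff_continuousAt]
    intro θ
    refine ContinuousAt.clog ?_ (Or.inl (hzz θ).2.2)
    exact ContinuousAt.comp (f := z) (hgat _ (hzz θ).1 (hzz θ).2.1) hzc.continuousAt
  have hgne : ∀ θ, g (z θ) ≠ 0 := fun θ h => by
    have := (hzz θ).2.2
    rw [h] at this; simp at this
  have key := exp_const (s := Set.univ) (f := fun θ : ℝ =>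
      φ (pt (v (z θ))) - Complex.log (g (z θ)) - n₁ * (θ * Complex.I)) isPreconnected_univ
      ((c1.sub c2).sub (by fun_prop)).continuousOn (by
        have : ∀ θ : ℝ, Complex.exp (φ (pt (v (z θ))) - Complex.log (g (z θ)) - n₁ * (θ * Complex.I))
            = ((r / 2 : ℝ) : ℂ) ^ n₁ * (ev b v₀ ^ n₂ * ev c v₀ ^ n₃) := by
          intro θ
          rw [Complex.exp_sub, Complex.exp_sub, Complex.exp_log (hgne θ),
            ← h (v (z θ)) (by rw [hva]; exact hz0 θ) (hzz θ).1 (hzz θ).2.1, hva, Complex.exp_int_mul]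
          simp only [hg, hz, mul_zpow, div_zpow]
          have k1 := zpow_ne_zero n₁ (Complex.exp_ne_zero (θ * Complex.I))
          have k2 := zpow_ne_zero n₂ (hzz θ).1
          have k3 := zpow_ne_zero n₃ (hzz θ).2.1
          simp only [hz] at k2 k3
          have k4 := zpow_ne_zero n₂ hvb
          have k5 := zpow_ne_zero n₃ hvc
          rw [div_div, div_eq_iff (by positivity)]
          field_simp
        intro x _ y _
        rw [this, this]) (Set.mem_univ 0) (Set.mem_univ (2 * Real.pi))
  have hzp : z (2 * Real.pi) = z 0 := by
    simp [hz]
  simp only [hzp] at key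
  have : (n₁ : ℂ) * (2 * Real.pi * Complex.I) = 0 := by
    push_cast at key
    linear_combination key
  have h2 := mul_eq_zero.1 this
  rcases h2 with h2 | h2
  · exact_mod_cast h2
  · exact absurd h2 Complex.two_pi_I_ne_zero

theorem lemC (a b c : W3) (φ : CP2 → ℂ)
    (hφ : ContinuousOn φ {p | ev a p.rep ≠ 0 ∧ ev b p.rep ≠ 0 ∧ ev c p.rep ≠ 0})
    (p q : CP2) (hp : ev a p.rep ≠ 0 ∧ ev b p.rep ≠ 0 ∧ ev c p.rep ≠ 0)
    (hq : ev a q.rep ≠ 0 ∧ ev b q.rep ≠ 0 ∧ ev c q.rep ≠ 0) (C : ℂ)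
    (h : ∀ x y : ℂ, ∀ v, v = x • p.rep + y • q.rep → ev a v ≠ 0 → ev b v ≠ 0 → ev c v ≠ 0 →
      Complex.exp (φ (pt v)) = C) : φ p = φ q := by
  set v : ℂ → W3 := fun z => (1 - z) • p.rep + z • q.rep with hv
  have hvc : Continuous v := by rw [hv]; fun_prop
  set B : W3 → Set ℂ := fun a => {z | ev a (v z) = 0} with hB
  have hfin : ∀ a, ev a p.rep ≠ 0 → (B a).Countable := by
    intro a ha
    apply Set.Subsingleton.countable
    intro x hx y hy
    simp only [hB, hv, Set.mem_ofPred_eq, ev_add, ev_smul] at hx hy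
    have : (x - y) * ev a p.rep = 0 := by
      linear_combination x * hy - y * hx
    exact sub_eq_zero.1 ((mul_eq_zero.1 this).resolve_right ha)
  have hS : IsPreconnected (B a ∪ (B b ∪ B c))ᶜ :=
    (Set.Countable.isPathConnected_compl_of_one_lt_rank (by simp)
      ((hfin a hp.1).union ((hfin b hp.2.1).union (hfin c hp.2.2)))).isConnected.isPreconnected
  have hmem : ∀ z, z ∈ (B a ∪ (B b ∪ B c))ᶜ → ev a (v z) ≠ 0 ∧ ev b (v z) ≠ 0 ∧ ev c (v z) ≠ 0 := by
    intro z hz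
    simpa [hB] using hz
  have hmem' : ∀ z, ev a (v z) ≠ 0 ∧ ev b (v z) ≠ 0 ∧ ev c (v z) ≠ 0 → z ∈ (B a ∪ (B b ∪ B c))ᶜ := by
    intro z hz
    simpa [hB] using hz
  have h0 : v 0 = p.rep := by simp [hv]
  have h1 : v 1 = q.rep := by simp [hv]
  have := exp_const hS (f := fun z => φ (pt (v z))) ?_ ?_ (hmem' 0 (by rw [h0]; exact hp))
    (hmem' 1 (by rw [h1]; exact hq))
  · simpa only [h0, h1, pt_rep] using this
  · refine hφ.comp (cont_pt.comp hvc.continuousOn ?_) ?_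
    · intro z hz; exact ne_of_ev (hmem z hz).1
    · intro z hz
      have hz := hmem z hz
      have hn := ne_of_ev hz.1
      exact ⟨(ev_pt_ne hn a).2 hz.1, (ev_pt_ne hn b).2 hz.2.1, (ev_pt_ne hn c).2 hz.2.2⟩
  · have : ∀ z ∈ (B a ∪ (B b ∪ B c))ᶜ, Complex.exp (φ (pt (v z))) = C := by
      intro z hz
      have hz := hmem z hz
      exact h _ _ _ rfl hz.1 hz.2.1 hz.2.2
    intro x hx y hy
    rw [this x hx, this y hy]
theorem lemE (a a' b b' : W3) (haa : cr a a' ≠ 0) (hbb : cr b b' ≠ 0) (h : CP2 ≃ₜ CP2)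
    (h1 : ∀ p : CP2, ev a p.rep ≠ 0 ↔ ev b (h p).rep ≠ 0)
    (h2 : ∀ p : CP2, ev a' p.rep ≠ 0 ↔ ev b' (h p).rep ≠ 0) :
    ∃ (m : ℤ) (φ : CP2 → ℂ), (m = 1 ∨ m = -1) ∧
      ContinuousOn φ {p | ev a p.rep ≠ 0 ∧ ev a' p.rep ≠ 0} ∧
      ∀ p : CP2, ev a p.rep ≠ 0 → ev a' p.rep ≠ 0 →
        ev b (h p).rep / ev b' (h p).rep =
          (ev a p.rep / ev a' p.rep) ^ m * Complex.exp (φ p) := by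
  have h1' : ∀ p : CP2, ev b p.rep ≠ 0 ↔ ev a (h.symm p).rep ≠ 0 := fun p => by
    rw [h1]; simp
  have h2' : ∀ p : CP2, ev b' p.rep ≠ 0 ↔ ev a' (h.symm p).rep ≠ 0 := fun p => by
    rw [h2]; simp
  obtain ⟨m, φ, hφ, H⟩ := lemA a a' haa (fun p => ev b (h p).rep / ev b' (h p).rep)
    ((cont_rat b b').comp h.continuous.continuousOn (fun p hp => (h2 p).1 hp.2))
    (fun p hp hp' => div_ne_zero ((h1 p).1 hp) ((h2 p).1 hp'))
  obtain ⟨m', φ', hφ', H'⟩ := lemA b b' hbb (fun p => ev a (h.symm p).rep / ev a' (h.symm p).rep)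
    ((cont_rat a a').comp h.symm.continuous.continuousOn (fun p hp => (h2' p).1 hp.2))
    (fun p hp hp' => div_ne_zero ((h1' p).1 hp) ((h2' p).1 hp'))
  refine ⟨m, φ, ?_, hφ, H⟩
  have key : 1 - m * m' = 0 := by
    refine lemL a a' a' haa haa (1 - m * m') (-(1 - m * m')) 0 (fun p => m' * φ p + φ' (h p)) ?_ ?_
    · refine ContinuousOn.add (ContinuousOn.mul continuousOn_const (hφ.mono ?_))
        (hφ'.comp h.continuous.continuousOn ?_)
      · intro p hp; exact ⟨hp.1, hp.2.1⟩
      · intro p hp; exact ⟨(h1 p).1 hp.1, (h2 p).1 hp.2.1⟩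
    · intro v hv hv' _
      have hn := ne_of_ev hv
      have e1 := (ev_pt_ne hn a).2 hv
      have e2 := (ev_pt_ne hn a').2 hv'
      have A1 := H (pt v) e1 e2
      have A2 := H' (h (pt v)) ((h1 _).1 e1) ((h2 _).1 e2)
      simp only [Homeomorph.symm_apply_apply, rat_pt hn] at A1 A2
      rw [A1, mul_zpow, ← Complex.exp_int_mul, ← zpow_mul, mul_assoc, ← Complex.exp_add] at A2
      have hr : ev a v / ev a' v ≠ 0 := div_ne_zero hv hv'
      rw [zpow_zero, mul_one, zpow_neg, ← div_eq_mul_inv, ← div_zpow, zpow_sub₀ hr, zpow_one,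
        div_eq_iff (zpow_ne_zero _ hr), mul_comm, ← A2]
  exact Int.eq_one_or_neg_one_of_mul_eq_one (by linarith : m * m' = 1)

theorem exists_base {ι : Type*} [Finite ι] (a : ι → W3) (ha : ∀ k, a k ≠ 0) :
    ∃ v, ∀ k, ev (a k) v ≠ 0 := by
  by_contra! hcon
  let L : ι → (W3 →ₗ[ℂ] ℂ) := fun k =>
    { toFun := ev (a k), map_add' := ev_add _, map_smul' := fun c v => ev_smul _ _ _ }
  obtain ⟨k, hk⟩ := Subspace.exists_eq_top_of_iUnion_eq_univ (k := ℂ) (E := W3)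
    (p := fun k => LinearMap.ker (L k)) (by
      ext v; simp only [Set.mem_iUnion, Set.mem_univ, iff_true]
      exact hcon v)
  apply ha k
  have hz : ∀ v, ev (a k) v = 0 := fun v => by
    have : v ∈ LinearMap.ker (L k) := by rw [hk]; trivial
    exact this
  funext i
  fin_cases i
  · simpa [ev] using hz ![1, 0, 0]
  · simpa [ev] using hz ![0, 1, 0]
  · simpa [ev] using hz ![0, 0, 1]

theorem core {ι : Type*} [Finite ι] (a b : ι → W3) (ha : ∀ k l, k ≠ l → cr (a k) (a l) ≠ 0)
    (hb : ∀ k l, k ≠ l → cr (b k) (b l) ≠ 0) (h : CP2 ≃ₜ CP2)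
    (hh : ∀ k (p : CP2), ev (a k) p.rep ≠ 0 ↔ ev (b k) (h p).rep ≠ 0)
    (k0 k1 : ι) (h01 : k0 ≠ k1) :
    ∃ ε : ℤ, (ε = 1 ∨ ε = -1) ∧ ∃ u : ι → CP2 → ℂ,
      (∀ k l (p : CP2), ev (a k) p.rep ≠ 0 → ev (a l) p.rep ≠ 0 → Complex.exp (u k p - u l p) =
        (ev (b k) (h p).rep / ev (b l) (h p).rep) / (ev (a k) p.rep / ev (a l) p.rep) ^ ε) ∧
      (∀ m k l (r r' : ℂ), r ≠ 0 → (∀ v, ev (a m) v = 0 → ev (a k) v = r * ev (a l) v) →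
        (∀ v, ev (b m) v = 0 → ev (b k) v = r' * ev (b l) v) →
        ∀ p q : CP2, ev (a m) p.rep = 0 → ev (a m) q.rep = 0 → ev (a k) p.rep ≠ 0 →
          ev (a k) q.rep ≠ 0 → u k p - u l p = u k q - u l q) := by
  classical
  have E : ∀ k l, ∃ (m : ℤ) (φ : CP2 → ℂ), k ≠ l → ((m = 1 ∨ m = -1) ∧
      ContinuousOn φ {p | ev (a k) p.rep ≠ 0 ∧ ev (a l) p.rep ≠ 0} ∧
      ∀ p : CP2, ev (a k) p.rep ≠ 0 → ev (a l) p.rep ≠ 0 →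
        ev (b k) (h p).rep / ev (b l) (h p).rep =
          (ev (a k) p.rep / ev (a l) p.rep) ^ m * Complex.exp (φ p)) := by
    intro k l
    by_cases hkl : k = l
    · exact ⟨0, 0, fun h => absurd hkl h⟩
    · obtain ⟨m, φ, H⟩ := lemE (a k) (a l) (b k) (b l) (ha k l hkl) (hb k l hkl) h (hh k) (hh l)
      exact ⟨m, φ, fun _ => H⟩
  choose m φ H using E
  have cl1 : ∀ k l n, k ≠ l → k ≠ n → m k l = m k n := by
    intro k l n hkl hkn
    by_cases hln : l = n
    · rw [hln]
    obtain ⟨-, c1, e1⟩ := H k l hkl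
    obtain ⟨-, c2, e2⟩ := H l n hln
    obtain ⟨-, c3, e3⟩ := H k n hkn
    have := lemL (a k) (a l) (a n) (ha k l hkl) (ha k n hkn) (m k l - m k n) (m l n - m k l)
      (m k n - m l n) (fun p => φ k n p - φ k l p - φ l n p) ?_ ?_
    · linarith
    · refine ((c3.mono ?_).sub (c1.mono ?_)).sub (c2.mono ?_)
      · intro p hp; exact ⟨hp.1, hp.2.2⟩
      · intro p hp; exact ⟨hp.1, hp.2.1⟩
      · intro p hp; exact ⟨hp.2.1, hp.2.2⟩
    · intro v hk hl hn
      have hv := ne_of_ev hk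
      have i1 := (ev_pt_ne hv (a k)).2 hk
      have i2 := (ev_pt_ne hv (a l)).2 hl
      have i3 := (ev_pt_ne hv (a n)).2 hn
      have f1 := e1 _ i1 i2
      have f2 := e2 _ i2 i3
      have f3 := e3 _ i1 i3
      have hbl := (hh l _).1 i2
      rw [← div_mul_div_cancel₀ hbl, f1, f2] at f3
      simp only [rat_pt hv, div_zpow] at f3
      rw [Complex.exp_sub, Complex.exp_sub, zpow_sub₀ hk, zpow_sub₀ hl, zpow_sub₀ hn]
      have := zpow_ne_zero (m k l) hk
      have := zpow_ne_zero (m k n) hk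
      have := zpow_ne_zero (m k l) hl
      have := zpow_ne_zero (m l n) hl
      have := zpow_ne_zero (m k n) hn
      have := zpow_ne_zero (m l n) hn
      have := Complex.exp_ne_zero (φ k l (pt v))
      have := Complex.exp_ne_zero (φ l n (pt v))
      field_simp at f3 ⊢
      linear_combination f3
  have cl2 : ∀ k l, k ≠ l → m k l = m l k := by
    intro k l hkl
    obtain ⟨-, c1, e1⟩ := H k l hkl
    obtain ⟨-, c2, e2⟩ := H l k hkl.symm
    have := lemL (a k) (a l) (a l) (ha k l hkl) (ha k l hkl) (m k l - m l k) (m l k - m k l)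
      0 (fun p => - φ k l p - φ l k p) ?_ ?_
    · linarith
    · refine (c1.mono ?_).neg.sub (c2.mono ?_)
      · intro p hp; exact ⟨hp.1, hp.2.1⟩
      · intro p hp; exact ⟨hp.2.1, hp.1⟩
    · intro v hk hl _
      have hv := ne_of_ev hk
      have i1 := (ev_pt_ne hv (a k)).2 hk
      have i2 := (ev_pt_ne hv (a l)).2 hl
      have f1 := e1 _ i1 i2
      have f2 := e2 _ i2 i1
      have hbl := (hh l _).1 i2
      have hbk := (hh k _).1 i1
      have f3 : ev (b k) (h (pt v)).rep / ev (b l) (h (pt v)).rep *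
          (ev (b l) (h (pt v)).rep / ev (b k) (h (pt v)).rep) = 1 := by
        rw [div_mul_div_cancel₀ hbl, div_self hbk]
      rw [f1, f2] at f3
      simp only [rat_pt hv, div_zpow] at f3
      rw [Complex.exp_sub, Complex.exp_neg, zpow_sub₀ hk, zpow_sub₀ hl]
      have := zpow_ne_zero (m k l) hk
      have := zpow_ne_zero (m l k) hk
      have := zpow_ne_zero (m k l) hl
      have := zpow_ne_zero (m l k) hl
      have := Complex.exp_ne_zero (φ k l (pt v))
      have := Complex.exp_ne_zero (φ l k (pt v))
      field_simp at f3 ⊢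
      linear_combination f3
  have hε : ∀ k l, k ≠ l → m k l = m k0 k1 := by
    intro k l hkl
    by_cases hk : k = k0
    · subst hk; exact cl1 _ _ _ hkl h01
    · rw [cl1 k l k0 hkl hk, cl2 k k0 hk, cl1 k0 k k1 (Ne.symm hk) h01]
  obtain ⟨ε, hεd⟩ : ∃ ε, ε = m k0 k1 := ⟨_, rfl⟩
  refine ⟨ε, hεd ▸ (H k0 k1 h01).1, ?_⟩
  obtain ⟨v0, hv0⟩ := exists_base a (by
    intro k hk
    have : ∃ l, k ≠ l := by
      by_cases h : k = k0
      · exact ⟨k1, h ▸ h01⟩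
      · exact ⟨k0, h⟩
    obtain ⟨l, hl⟩ := this
    apply ha k l hl
    rw [hk]; funext i; fin_cases i <;> simp [cr])
  have hv0n : v0 ≠ 0 := ne_of_ev (hv0 k0)
  obtain ⟨p0, hp0⟩ : ∃ p0 : CP2, ∀ k, ev (a k) p0.rep ≠ 0 :=
    ⟨pt v0, fun k => (ev_pt_ne hv0n _).2 (hv0 k)⟩
  obtain ⟨t, ht⟩ : ∃ t : ι → ℂ, ∀ k, Complex.exp (t k) = ev (b k) (h p0).rep / ev (a k) p0.rep ^ ε :=
    ⟨fun k => Complex.log (ev (b k) (h p0).rep / ev (a k) p0.rep ^ ε), fun k =>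
      Complex.exp_log (div_ne_zero ((hh k _).1 (hp0 k)) (zpow_ne_zero _ (hp0 k)))⟩
  have E2 : ∀ k l, ∃ Φ : CP2 → ℂ,
      ContinuousOn Φ {p | ev (a k) p.rep ≠ 0 ∧ ev (a l) p.rep ≠ 0} ∧
      Φ p0 = t k - t l ∧
      ∀ p : CP2, ev (a k) p.rep ≠ 0 → ev (a l) p.rep ≠ 0 → Complex.exp (Φ p) =
        (ev (b k) (h p).rep / ev (b l) (h p).rep) / (ev (a k) p.rep / ev (a l) p.rep) ^ ε := by
    intro k l
    by_cases hkl : k = l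
    · subst hkl
      refine ⟨0, continuousOn_const, by simp, fun p hp _ => ?_⟩
      rw [div_self hp, div_self ((hh k p).1 hp)]; simp
    · obtain ⟨-, c1, e1⟩ := H k l hkl
      rw [hε k l hkl, ← hεd] at e1
      have e1' : ∀ p : CP2, ev (a k) p.rep ≠ 0 → ev (a l) p.rep ≠ 0 → Complex.exp (φ k l p) =
        (ev (b k) (h p).rep / ev (b l) (h p).rep) / (ev (a k) p.rep / ev (a l) p.rep) ^ ε := by
        intro p hk hl
        rw [e1 p hk hl, mul_div_cancel_left₀ _ (zpow_ne_zero _ (div_ne_zero hk hl))]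
      refine ⟨fun p => φ k l p + (t k - t l - φ k l p0), c1.add continuousOn_const, by ring, ?_⟩
      intro p hk hl
      rw [Complex.exp_add, e1' p hk hl, Complex.exp_sub, e1' p0 (hp0 k) (hp0 l), Complex.exp_sub,
        ht, ht]
      have j1 := (hh k p0).1 (hp0 k)
      have j2 := (hh l p0).1 (hp0 l)
      have j3 := zpow_ne_zero ε (hp0 k)
      have j4 := zpow_ne_zero ε (hp0 l)
      rw [div_zpow (ev (a k) p0.rep)]
      have j5 : ev (b k) (h p0).rep / ev (a k) p0.rep ^ ε / (ev (b l) (h p0).rep / ev (a l) p0.rep ^ ε)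
          / (ev (b k) (h p0).rep / ev (b l) (h p0).rep / (ev (a k) p0.rep ^ ε / ev (a l) p0.rep ^ ε))
          = 1 := by field_simp
      rw [j5, mul_one]
  choose Φ Φc Φ0 Φe using E2
  have coc : ∀ k l n (p : CP2), ev (a k) p.rep ≠ 0 → ev (a l) p.rep ≠ 0 → ev (a n) p.rep ≠ 0 →
      Φ k l p + Φ l n p = Φ k n p := by
    intro k l n p hk hl hn
    have := lemC (a k) (a l) (a n) (fun p => Φ k l p + Φ l n p - Φ k n p) ?_ p p0 ⟨hk, hl, hn⟩
      ⟨hp0 k, hp0 l, hp0 n⟩ 1 ?_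
    · simp only [Φ0] at this
      linear_combination this
    · refine (((Φc k l).mono ?_).add ((Φc l n).mono ?_)).sub ((Φc k n).mono ?_)
      · intro p hp; exact ⟨hp.1, hp.2.1⟩
      · intro p hp; exact ⟨hp.2.1, hp.2.2⟩
      · intro p hp; exact ⟨hp.1, hp.2.2⟩
    · intro _ _ v _ hk hl hn
      have hv := ne_of_ev hk
      have i1 := (ev_pt_ne hv (a k)).2 hk
      have i2 := (ev_pt_ne hv (a l)).2 hl
      have i3 := (ev_pt_ne hv (a n)).2 hn
      rw [Complex.exp_sub, Complex.exp_add, Φe k l _ i1 i2, Φe l n _ i2 i3, Φe k n _ i1 i3,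
        div_mul_div_comm, div_mul_div_cancel₀ ((hh l _).1 i2), ← mul_zpow, div_mul_div_cancel₀ i2,
        div_self]
      exact div_ne_zero (div_ne_zero ((hh k _).1 i1) ((hh n _).1 i3))
        (zpow_ne_zero _ (div_ne_zero i1 i3))
  have hl0 : ∀ p : CP2, ∃ l, ∀ k, ev (a k) p.rep ≠ 0 → ev (a l) p.rep ≠ 0 := by
    intro p
    by_cases hp : ∃ l, ev (a l) p.rep ≠ 0
    · exact ⟨hp.choose, fun _ _ => hp.choose_spec⟩
    · push Not at hp
      exact ⟨k0, fun k hk => absurd (hp k) hk⟩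
  choose l0 hl0 using hl0
  have hu : ∀ k l (p : CP2), ev (a k) p.rep ≠ 0 → ev (a l) p.rep ≠ 0 →
      Φ k (l0 p) p - Φ l (l0 p) p = Φ k l p := by
    intro k l p hk hl
    rw [← coc k l (l0 p) p hk hl (hl0 p k hk)]; ring
  refine ⟨fun k p => Φ k (l0 p) p, ?_, ?_⟩
  · intro k l p hk hl
    simp only [hu k l p hk hl]
    exact Φe k l p hk hl
  · intro n k l r r' hr h1 h2 p q hp hq hkp hkq
    have hlp : ev (a l) p.rep ≠ 0 := fun h => hkp (by rw [h1 _ hp, h, mul_zero])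
    have hlq : ev (a l) q.rep ≠ 0 := fun h => hkq (by rw [h1 _ hq, h, mul_zero])
    simp only [hu k l p hkp hlp, hu k l q hkq hlq]
    refine lemC (a k) (a l) (a l) (Φ k l) ((Φc k l).mono ?_) p q ⟨hkp, hlp, hlp⟩ ⟨hkq, hlq, hlq⟩
      (r' / r ^ ε) ?_
    · intro p hp; exact ⟨hp.1, hp.2.1⟩
    · intro x y v hv hk hl _
      have hvn := ne_of_ev hk
      have i1 := (ev_pt_ne hvn (a k)).2 hk
      have i2 := (ev_pt_ne hvn (a l)).2 hl
      have i3 : ev (a n) (pt v).rep = 0 := by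
        rw [ev_pt_zero hvn, hv, ev_add, ev_smul, ev_smul, hp, hq]; simp
      have i4 : ev (b n) (h (pt v)).rep = 0 := by
        by_contra hc
        exact (hh n _).2 hc i3
      rw [Φe k l _ i1 i2, h1 _ i3, h2 _ i4, mul_div_cancel_right₀ _ i2,
        mul_div_cancel_right₀ _ ((hh l _).1 i2)]

section comb
open Polynomial

def lfR {A : Type*} [CommRing A] (x : A) : Fin 11 → Fin 3 → A :=
  ![![0, 0, 1], ![x, -1, 1], ![x ^ 2 + x, -x, x + 1], ![1, 0, 0], ![1, x, -(x + 1)],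
    ![x + 1, -1, 0], ![1, 0, -1], ![x, x ^ 2, -(x ^ 3 + x ^ 2 + x)], ![0, 1, 0], ![0, 1, -1],
    ![0, x ^ 2 + 1, -(x ^ 2 + x + 1)]]

/-- the multiple points used in the proof -/
def ptR {A : Type*} [CommRing A] (x : A) : Fin 13 → Fin 3 → A :=
  ![![1, x, 0], ![1, x + 1, 0], ![0, 1, 0], ![x, -1, 0], ![1, 0, 0], ![1, 0, -x], ![0, 1, 1],
    ![1, x ^ 2 + x + 1, x ^ 2 + 1], ![1, x + 1, 1], ![0, x + 1, x],
    ![x ^ 4 + x ^ 2 + 1, x ^ 2 + x + 1, x ^ 2 + 1], ![0, 0, 1], ![1, 1, 1]]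

def inc : Fin 13 → List (Fin 11) :=
  ![[0, 1], [0, 2, 5], [0, 3, 6], [0, 4, 7], [0, 8, 9, 10], [1, 2, 8], [1, 3, 9], [1, 4, 10],
    [1, 5, 6, 7], [2, 3, 4], [2, 7, 10], [3, 5, 8], [4, 6, 9]]

def evR {A : Type*} [CommRing A] (a v : Fin 3 → A) : A := a 0 * v 0 + a 1 * v 1 + a 2 * v 2

def crR {A : Type*} [CommRing A] (a b : Fin 3 → A) : Fin 3 → A :=
  ![a 1 * b 2 - a 2 * b 1, a 2 * b 0 - a 0 * b 2, a 0 * b 1 - a 1 * b 0]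

theorem map_lfR {A B : Type*} [CommRing A] [CommRing B] (f : A →+* B) (x : A) (k : Fin 11)
    (i : Fin 3) : f (lfR x k i) = lfR (f x) k i := by
  fin_cases k <;> fin_cases i <;> simp [lfR]

theorem map_ptR {A B : Type*} [CommRing A] [CommRing B] (f : A →+* B) (x : A) (k : Fin 13)
    (i : Fin 3) : f (ptR x k i) = ptR (f x) k i := by
  fin_cases k <;> fin_cases i <;> simp [ptR]

theorem map_evR {A B : Type*} [CommRing A] [CommRing B] (f : A →+* B) (x : A) (k : Fin 11)
    (R : Fin 13) : f (evR (lfR x k) (ptR x R)) = evR (lfR (f x) k) (ptR (f x) R) := by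
  simp [evR, map_lfR, map_ptR]

theorem map_crR {A B : Type*} [CommRing A] [CommRing B] (f : A →+* B) (x : A) (k l : Fin 11)
    (i : Fin 3) : f (crR (lfR x k) (lfR x l) i) = crR (lfR (f x) k) (lfR (f x) l) i := by
  fin_cases i <;> simp [crR, map_lfR]

theorem prim {α : ℂ} (hα : α ^ 6 + α ^ 5 + α ^ 4 + α ^ 3 + α ^ 2 + α + 1 = 0) :
    IsPrimitiveRoot α 7 := by
  have : Fact (Nat.Prime 7) := ⟨by norm_num⟩
  have h7 : α ^ 7 = 1 := by linear_combination (α - 1) * hα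
  have h1 : α ≠ 1 := by rintro rfl; norm_num at hα
  rw [← orderOf_eq_prime h7 h1]
  exact IsPrimitiveRoot.orderOf α

/-- reduction modulo a prime above 29 -/
theorem red {α : ℂ} (hα : α ^ 6 + α ^ 5 + α ^ 4 + α ^ 3 + α ^ 2 + α + 1 = 0) (F : ℤ[X])
    (hF : aeval α F = 0) : aeval (7 : ZMod 29) F = 0 := by
  have hp := prim hα
  have hm := cyclotomic_eq_minpoly hp (by norm_num)
  have hd : cyclotomic 7 ℤ ∣ F := by
    rw [hm]
    exact minpoly.isIntegrallyClosed_dvd (hp.isIntegral (by norm_num)) hF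
  obtain ⟨G, rfl⟩ := hd
  have : Fact (Nat.Prime 7) := ⟨by norm_num⟩
  rw [map_mul, cyclotomic_prime]
  have : aeval (7 : ZMod 29) (∑ i ∈ Finset.range 7, (X : ℤ[X]) ^ i) = 0 := by
    simp only [map_sum, map_pow, aeval_X]
    decide
  rw [this, zero_mul]

set_option maxRecDepth 100000 in
theorem tab1 : ∀ (R : Fin 13) (k : Fin 11), k ∉ inc R →
    evR (lfR (7 : ZMod 29) k) (ptR (7 : ZMod 29) R) ≠ 0 := by decide

set_option maxRecDepth 100000 in
theorem tab2 : ∀ k l : Fin 11, k ≠ l →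
    ¬ ∀ i, crR (lfR (7 : ZMod 29) k) (lfR (7 : ZMod 29) l) i = 0 := by decide

theorem nin {α : ℂ} (hα : α ^ 6 + α ^ 5 + α ^ 4 + α ^ 3 + α ^ 2 + α + 1 = 0)
    (R : Fin 13) (k : Fin 11) (h : k ∉ inc R) : ev (lfR α k) (ptR α R) ≠ 0 := by
  intro h0
  have h1 := map_evR (aeval α : ℤ[X] →ₐ[ℤ] ℂ).toRingHom X k R
  have h2 := map_evR (aeval (7 : ZMod 29) : ℤ[X] →ₐ[ℤ] ZMod 29).toRingHom X k R
  simp only [AlgHom.toRingHom_eq_coe, RingHom.coe_coe, aeval_X] at h1 h2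
  exact tab1 R k h (by rw [← h2]; exact red hα _ (h1.trans h0))

theorem crn {α : ℂ} (hα : α ^ 6 + α ^ 5 + α ^ 4 + α ^ 3 + α ^ 2 + α + 1 = 0)
    (k l : Fin 11) (h : k ≠ l) : cr (lfR α k) (lfR α l) ≠ 0 := by
  intro h0
  refine tab2 k l h (fun i => ?_)
  have h1 := map_crR (aeval α : ℤ[X] →ₐ[ℤ] ℂ).toRingHom X k l i
  have h2 := map_crR (aeval (7 : ZMod 29) : ℤ[X] →ₐ[ℤ] ZMod 29).toRingHom X k l i
  simp only [AlgHom.toRingHom_eq_coe, RingHom.coe_coe, aeval_X] at h1 h2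
  rw [← h2]
  exact red hα _ (h1.trans (congrFun h0 i))

theorem yin {α : ℂ} (hα : α ^ 6 + α ^ 5 + α ^ 4 + α ^ 3 + α ^ 2 + α + 1 = 0)
    (R : Fin 13) : ∀ k ∈ inc R, ev (lfR α k) (ptR α R) = 0 := by
  fin_cases R <;> simp [inc, lfR, ptR, ev] <;>
    first
    | done
    | ring1
    | linear_combination hα
    | (refine ⟨?_, ?_⟩ <;> first | ring1 | linear_combination hα)
    | (refine ⟨?_, ?_, ?_⟩ <;> first | ring1 | linear_combination hα)


end comb

theorem cr_par {a b w : W3} (hw : w ≠ 0) (h1 : ev a w = 0) (h2 : ev b w = 0) :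
    ∃ s : ℂ, cr a b = s • w := by
  have hw' : w 0 ≠ 0 ∨ w 1 ≠ 0 ∨ w 2 ≠ 0 := by
    by_contra! h
    apply hw
    funext i
    fin_cases i
    · exact h.1
    · exact h.2.1
    · exact h.2.2
  simp only [ev] at h1 h2
  rcases hw' with h | h | h
  · refine ⟨cr a b 0 / w 0, ?_⟩
    funext i
    fin_cases i <;> simp [cr] <;> field_simp
    · linear_combination a 2 * h2 - b 2 * h1
    · linear_combination -a 1 * h2 + b 1 * h1
  · refine ⟨cr a b 1 / w 1, ?_⟩
    funext i
    fin_cases i <;> simp [cr] <;> field_simp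
    · linear_combination -a 2 * h2 + b 2 * h1
    · linear_combination a 0 * h2 - b 0 * h1
  · refine ⟨cr a b 2 / w 2, ?_⟩
    funext i
    fin_cases i <;> simp [cr] <;> field_simp
    · linear_combination a 1 * h2 - b 1 * h1
    · linear_combination -a 0 * h2 + b 0 * h1

theorem prop_on {m k l w : W3} (hw : w ≠ 0) (h1 : ev m w = 0) (h2 : ev k w = 0)
    (h3 : ev l w = 0) (hk : cr m k ≠ 0) (hl : cr m l ≠ 0) :
    ∃ r : ℂ, r ≠ 0 ∧ ∀ v, ev m v = 0 → ev k v = r * ev l v := by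
  obtain ⟨s, hs⟩ := cr_par hw h1 h2
  obtain ⟨t, ht⟩ := cr_par hw h1 h3
  have hs0 : s ≠ 0 := by rintro rfl; exact hk (by simpa using hs)
  have ht0 : t ≠ 0 := by rintro rfl; exact hl (by simpa using ht)
  refine ⟨s / t, div_ne_zero hs0 ht0, fun v hv => ?_⟩
  have hm : m ≠ 0 := by
    rintro rfl; apply hk; funext i; fin_cases i <;> simp [cr]
  have e : ∀ i, m i * (t * ev k v - s * ev l v) = 0 := by
    have s0 := congrFun hs 0
    have s1 := congrFun hs 1
    have s2 := congrFun hs 2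
    have t0 := congrFun ht 0
    have t1 := congrFun ht 1
    have t2 := congrFun ht 2
    simp [cr] at s0 s1 s2 t0 t1 t2
    simp only [ev] at hv ⊢
    intro i
    fin_cases i
    · show m 0 * _ = 0
      linear_combination t * (k 0 * hv + v 1 * s2 - v 2 * s1) - s * (l 0 * hv + v 1 * t2 - v 2 * t1)
    · show m 1 * _ = 0
      linear_combination t * (k 1 * hv + v 2 * s0 - v 0 * s2) - s * (l 1 * hv + v 2 * t0 - v 0 * t2)
    · show m 2 * _ = 0
      linear_combination t * (k 2 * hv + v 0 * s1 - v 1 * s0) - s * (l 2 * hv + v 0 * t1 - v 1 * t0)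
  have e' : t * ev k v - s * ev l v = 0 := by
    by_contra hc
    exact hm (funext fun i => (mul_eq_zero.1 (e i)).resolve_right hc)
  field_simp
  linear_combination e'

theorem exists_gen {ι : Type*} [Finite ι] (a : ι → W3) (ha : ∀ k l, k ≠ l → cr (a k) (a l) ≠ 0)
    (m : ι) : ∃ v, ev (a m) v = 0 ∧ ∀ k, k ≠ m → ev (a k) v ≠ 0 := by
  obtain ⟨v, hv⟩ := exists_base (fun k : {k // k ≠ m} => cr (a k) (a m)) (fun k => ha _ _ k.2)
  refine ⟨cr (a m) v, by simp [ev, cr]; ring, fun k hk => ?_⟩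
  have := hv ⟨k, hk⟩
  simp only [ev, cr] at this ⊢
  simp at this ⊢
  intro h; apply this; linear_combination h

def ok (R Q : Fin 13) (m k l : Fin 11) : Prop :=
  m ∈ inc R ∧ k ∉ inc R ∧ m ∈ inc Q ∧ k ∈ inc Q ∧ l ∈ inc Q ∧ m ≠ k ∧ m ≠ l

instance (R Q : Fin 13) (m k l : Fin 11) : Decidable (ok R Q m k l) := by
  unfold ok; infer_instance

theorem alg (U : Fin 11 → Fin 11 → ℂ) (V : Fin 13 → Fin 11 → ℂ)
    (e : ∀ R Q m k l, ok R Q m k l → V R k - V R l = U m k - U m l) :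
    (U 1 7 - U 1 5) + (U 2 10 - U 2 7) + (U 4 7 - U 4 0) +
      (U 0 9 - U 0 8) + (U 7 5 - U 7 1) + (U 7 10 - U 7 2) =
    (U 0 10 - U 0 8) + (U 1 6 - U 1 5) + (U 10 7 - U 10 2) +
      (U 4 10 - U 4 1) + (U 4 9 - U 4 6) + (U 2 5 - U 2 0) := by
  have z0 : (U 0 2 - U 0 5) + (U 1 5 - U 1 7) + (U 0 7 - U 0 4) + (U 1 4 - U 1 10) + (U 0 10 - U 0 8) + (U 1 8 - U 1 2) = 0 := by
    linear_combination - e 0 1 0 2 5 (by decide) - e 0 8 1 5 7 (by decide) - e 0 3 0 7 4 (by decide) - e 0 7 1 4 10 (by decide) - e 0 4 0 10 8 (by decide) - e 0 5 1 8 2 (by decide)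
  have z1 : (U 3 2 - U 3 4) + (U 0 4 - U 0 7) + (U 6 7 - U 6 5) + (U 0 5 - U 0 2) = 0 := by
    linear_combination - e 2 9 3 2 4 (by decide) - e 2 3 0 4 7 (by decide) - e 2 8 6 7 5 (by decide) - e 2 1 0 5 2 (by decide)
  have z2 : (U 5 0 - U 5 2) + (U 1 2 - U 1 8) + (U 5 8 - U 5 3) + (U 6 3 - U 6 0) = 0 := by
    linear_combination - e 8 1 5 0 2 (by decide) - e 8 5 1 2 8 (by decide) - e 8 11 5 8 3 (by decide) - e 8 2 6 3 0 (by decide)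
  have z3 : (U 3 0 - U 3 6) + (U 9 6 - U 9 4) + (U 1 4 - U 1 10) + (U 9 10 - U 9 0) = 0 := by
    linear_combination - e 6 2 3 0 6 (by decide) - e 6 12 9 6 4 (by decide) - e 6 7 1 4 10 (by decide) - e 6 4 9 10 0 (by decide)
  have z4 : (U 2 3 - U 2 4) + (U 0 4 - U 0 7) + (U 2 7 - U 2 10) + (U 0 10 - U 0 8) + (U 5 8 - U 5 3) = 0 := by
    linear_combination - e 1 9 2 3 4 (by decide) - e 1 3 0 4 7 (by decide) - e 1 10 2 7 10 (by decide) - e 1 4 0 10 8 (by decide) - e 1 11 5 8 3 (by decide)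
  have z5 : (U 3 2 - U 3 4) + (U 9 4 - U 9 6) + (U 1 6 - U 1 5) + (U 3 5 - U 3 8) + (U 1 8 - U 1 2) = 0 := by
    linear_combination - e 6 9 3 2 4 (by decide) - e 6 12 9 4 6 (by decide) - e 6 8 1 6 5 (by decide) - e 6 11 3 5 8 (by decide) - e 6 5 1 8 2 (by decide)
  have z6 : (U 4 0 - U 4 7) + (U 10 7 - U 10 2) + (U 1 2 - U 1 8) + (U 10 8 - U 10 0) = 0 := by
    linear_combination - e 7 3 4 0 7 (by decide) - e 7 10 10 7 2 (by decide) - e 7 5 1 2 8 (by decide) - e 7 4 10 8 0 (by decide)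
  have z7 : (U 6 1 - U 6 5) + (U 3 5 - U 3 8) + (U 0 8 - U 0 9) + (U 3 9 - U 3 1) = 0 := by
    linear_combination - e 2 8 6 1 5 (by decide) - e 2 11 3 5 8 (by decide) - e 2 4 0 8 9 (by decide) - e 2 6 3 9 1 (by decide)
  have z8 : (U 7 1 - U 7 5) + (U 0 5 - U 0 2) + (U 7 2 - U 7 10) + (U 4 10 - U 4 1) = 0 := by
    linear_combination - e 3 8 7 1 5 (by decide) - e 3 1 0 5 2 (by decide) - e 3 10 7 2 10 (by decide) - e 3 7 4 10 1 (by decide)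
  have z9 : (U 4 0 - U 4 7) + (U 6 7 - U 6 1) + (U 4 1 - U 4 10) + (U 9 10 - U 9 0) = 0 := by
    linear_combination - e 12 3 4 0 7 (by decide) - e 12 8 6 7 1 (by decide) - e 12 7 4 1 10 (by decide) - e 12 4 9 10 0 (by decide)
  have z10 : (U 8 1 - U 8 2) + (U 10 2 - U 10 7) + (U 0 7 - U 0 4) + (U 10 4 - U 10 1) = 0 := by
    linear_combination - e 4 5 8 1 2 (by decide) - e 4 10 10 2 7 (by decide) - e 4 3 0 7 4 (by decide) - e 4 7 10 4 1 (by decide)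
  have z11 : (U 3 0 - U 3 6) + (U 4 6 - U 4 9) + (U 3 9 - U 3 1) + (U 4 1 - U 4 10) + (U 2 10 - U 2 7) + (U 4 7 - U 4 0) = 0 := by
    linear_combination - e 9 2 3 0 6 (by decide) - e 9 12 4 6 9 (by decide) - e 9 6 3 9 1 (by decide) - e 9 7 4 1 10 (by decide) - e 9 10 2 10 7 (by decide) - e 9 3 4 7 0 (by decide)
  have z12 : (U 5 0 - U 5 2) + (U 8 2 - U 8 1) + (U 5 1 - U 5 6) + (U 3 6 - U 3 0) = 0 := by
    linear_combination - e 11 1 5 0 2 (by decide) - e 11 5 8 2 1 (by decide) - e 11 8 5 1 6 (by decide) - e 11 2 3 6 0 (by decide)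
  have z13 : (U 7 0 - U 7 4) + (U 10 4 - U 10 1) + (U 7 1 - U 7 5) + (U 2 5 - U 2 0) = 0 := by
    linear_combination - e 10 3 7 0 4 (by decide) - e 10 7 10 4 1 (by decide) - e 10 8 7 1 5 (by decide) - e 10 1 2 5 0 (by decide)
  have z14 : (U 2 3 - U 2 4) + (U 1 4 - U 1 10) + (U 2 10 - U 2 7) + (U 1 7 - U 1 5) + (U 8 5 - U 8 3) = 0 := by
    linear_combination - e 5 9 2 3 4 (by decide) - e 5 7 1 4 10 (by decide) - e 5 10 2 10 7 (by decide) - e 5 8 1 7 5 (by decide) - e 5 11 8 5 3 (by decide)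
  have z15 : (U 2 0 - U 2 5) + (U 3 5 - U 3 8) + (U 2 8 - U 2 1) + (U 4 1 - U 4 10) + (U 2 10 - U 2 7) + (U 4 7 - U 4 0) = 0 := by
    linear_combination - e 9 1 2 0 5 (by decide) - e 9 11 3 5 8 (by decide) - e 9 5 2 8 1 (by decide) - e 9 7 4 1 10 (by decide) - e 9 10 2 10 7 (by decide) - e 9 3 4 7 0 (by decide)
  have z16 : (U 2 0 - U 2 5) + (U 7 5 - U 7 1) + (U 2 1 - U 2 8) + (U 10 8 - U 10 9) + (U 10 9 - U 10 0) = 0 := by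
    linear_combination - e 10 1 2 0 5 (by decide) - e 10 8 7 5 1 (by decide) - e 10 5 2 1 8 (by decide) - e 10 4 10 8 9 (by decide) - e 10 4 10 9 0 (by decide)
  have z17 : (U 5 0 - U 5 2) + (U 7 2 - U 7 10) + (U 1 10 - U 1 4) + (U 7 4 - U 7 0) = 0 := by
    linear_combination - e 8 1 5 0 2 (by decide) - e 8 10 7 2 10 (by decide) - e 8 7 1 10 4 (by decide) - e 8 3 7 4 0 (by decide)
  have z18 : (U 8 1 - U 8 2) + (U 0 2 - U 0 5) + (U 8 5 - U 8 3) + (U 9 3 - U 9 1) = 0 := by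
    linear_combination - e 4 5 8 1 2 (by decide) - e 4 1 0 2 5 (by decide) - e 4 11 8 5 3 (by decide) - e 4 6 9 3 1 (by decide)
  have z19 : (U 6 0 - U 6 3) + (U 9 3 - U 9 1) + (U 6 1 - U 6 7) + (U 4 7 - U 4 0) = 0 := by
    linear_combination - e 12 2 6 0 3 (by decide) - e 12 6 9 3 1 (by decide) - e 12 8 6 1 7 (by decide) - e 12 3 4 7 0 (by decide)
  have z20 : (U 9 1 - U 9 3) + (U 0 3 - U 0 6) + (U 9 6 - U 9 4) + (U 10 4 - U 10 1) = 0 := by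
    linear_combination - e 4 6 9 1 3 (by decide) - e 4 2 0 3 6 (by decide) - e 4 12 9 6 4 (by decide) - e 4 7 10 4 1 (by decide)
  have z21 : (U 5 1 - U 5 6) + (U 0 6 - U 0 3) + (U 5 3 - U 5 8) + (U 2 8 - U 2 1) = 0 := by
    linear_combination - e 1 8 5 1 6 (by decide) - e 1 2 0 6 3 (by decide) - e 1 11 5 3 8 (by decide) - e 1 5 2 8 1 (by decide)
  have z22 : (U 0 3 - U 0 6) + (U 1 6 - U 1 7) + (U 0 7 - U 0 4) + (U 1 4 - U 1 10) + (U 0 10 - U 0 9) + (U 1 9 - U 1 3) = 0 := by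
    linear_combination - e 0 2 0 3 6 (by decide) - e 0 8 1 6 7 (by decide) - e 0 3 0 7 4 (by decide) - e 0 7 1 4 10 (by decide) - e 0 4 0 10 9 (by decide) - e 0 6 1 9 3 (by decide)
  have z23 : (U 4 2 - U 4 3) + (U 0 3 - U 0 6) + (U 4 6 - U 4 9) + (U 0 9 - U 0 10) + (U 7 10 - U 7 2) = 0 := by
    linear_combination - e 3 9 4 2 3 (by decide) - e 3 2 0 3 6 (by decide) - e 3 12 4 6 9 (by decide) - e 3 4 0 9 10 (by decide) - e 3 10 7 10 2 (by decide)
  have z24 : (U 4 2 - U 4 3) + (U 1 3 - U 1 9) + (U 4 9 - U 4 6) + (U 1 6 - U 1 7) + (U 10 7 - U 10 2) = 0 := by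
    linear_combination - e 7 9 4 2 3 (by decide) - e 7 6 1 3 9 (by decide) - e 7 12 4 9 6 (by decide) - e 7 8 1 6 7 (by decide) - e 7 10 10 7 2 (by decide)
  linear_combination (1 / 7) * ((1) * z0 + (1) * z1 + (3) * z2 + (-2) * z3 + (-2) * z4 + (-1) * z5 + (-3) * z6 + (-1) * z7 + (-2) * z8 + (2) * z9 + (1) * z10 + (1) * z11 + (-1) * z12 + (-2) * z13 + (2) * z14 + (2) * z15 + (3) * z16 + (-2) * z17 + (-2) * z18 + (3) * z19 + (1) * z20 + (1) * z21 + (-3) * z22 + (3) * z23 + (-3) * z24)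

def rho (α : ℂ) (R : Fin 13) (k l : Fin 11) : ℂ :=
  ev (lfR α k) (ptR α R) / ev (lfR α l) (ptR α R)

theorem rho_ne {α : ℂ} (hα : α ^ 6 + α ^ 5 + α ^ 4 + α ^ 3 + α ^ 2 + α + 1 = 0)
    (R : Fin 13) (k l : Fin 11) (hk : k ∉ inc R) (hl : l ∉ inc R) : rho α R k l ≠ 0 :=
  div_ne_zero (nin hα R k hk) (nin hα R l hl)

theorem ident {α : ℂ} (hα : α ^ 6 + α ^ 5 + α ^ 4 + α ^ 3 + α ^ 2 + α + 1 = 0) :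
    rho α 0 7 5 * rho α 9 10 7 * rho α 12 7 0 * rho α 2 9 8 * rho α 3 5 1 * rho α 8 10 2 =
    α * (rho α 2 10 8 * rho α 0 6 5 * rho α 4 7 2 * rho α 9 10 1 * rho α 3 9 6 * rho α 5 5 0) := by
  have h0 : α ≠ 0 := by rintro rfl; norm_num at hα
  have h1 : α + 1 ≠ 0 := by
    intro h
    have : α = -1 := by linear_combination h
    rw [this] at hα; norm_num at hα
  have h2 : α ^ 2 + 1 ≠ 0 := by
    intro h
    have : α = 0 := by linear_combination hα - (α ^ 4 + α ^ 3 + 1) * h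
    exact h0 this
  have r1 : rho α 0 7 5 = α ^ 3 + α := by simp [rho, ev, lfR, ptR]; ring
  have r2 : rho α 9 10 7 = 1 / (-α ^ 4) := by
    simp only [rho]; congr 1 <;> simp [ev, lfR, ptR] <;> ring
  have r3 : rho α 12 7 0 = -α ^ 3 := by simp [rho, ev, lfR, ptR]; ring
  have r4 : rho α 2 9 8 = 1 := by simp [rho, ev, lfR, ptR]
  have r5 : rho α 3 5 1 = (α ^ 2 + α + 1) / (α ^ 2 + 1) := by
    simp only [rho]; congr 1 <;> simp [ev, lfR, ptR] <;> ring
  have r6 : rho α 8 10 2 = α ^ 3 / (α + 1) := by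
    simp only [rho]; congr 1 <;> simp [ev, lfR, ptR] <;> ring
  have s1 : rho α 2 10 8 = α ^ 2 + 1 := by simp [rho, ev, lfR, ptR]
  have s2 : rho α 0 6 5 = 1 := by simp [rho, ev, lfR, ptR]
  have s3 : rho α 4 7 2 = 1 / (α + 1) := by
    simp [rho, ev, lfR, ptR]
    rw [show α ^ 2 + α = α * (α + 1) by ring]; field_simp
  have s4 : rho α 9 10 1 = -1 := by
    simp only [rho]
    rw [div_eq_iff (nin hα 9 1 (by decide))]
    simp [ev, lfR, ptR]; ring
  have s5 : rho α 3 9 6 = -1 / α := by simp [rho, ev, lfR, ptR]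
  have s6 : rho α 5 5 0 = (α + 1) / (-α) := by simp [rho, ev, lfR, ptR]
  rw [r1, r2, r3, r4, r5, r6, s1, s2, s3, s4, s5, s6]
  field_simp
  linear_combination hα

theorem mem_N (α : ℂ) (k : Fin 11) (p : CP2) : p ∈ Nline α k ↔ ev (lfR α k) p.rep = 0 := by
  fin_cases k <;> rfl

theorem final {α β : ℂ} (hα : α ^ 6 + α ^ 5 + α ^ 4 + α ^ 3 + α ^ 2 + α + 1 = 0)
    (hβ : β ^ 6 + β ^ 5 + β ^ 4 + β ^ 3 + β ^ 2 + β + 1 = 0) (h : CP2 ≃ₜ CP2)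
    (H : ∀ k, h '' Nline α k = Nline β k) : β = α ∨ β = α⁻¹ := by
  have hh : ∀ k (p : CP2), ev (lfR α k) p.rep ≠ 0 ↔ ev (lfR β k) (h p).rep ≠ 0 := by
    intro k p
    rw [not_iff_not, ← mem_N, ← mem_N, ← H k, h.injective.mem_set_image]
  obtain ⟨ε, hε, u, P3, P2⟩ := core (lfR α) (lfR β) (crn hα) (crn hβ) h hh 0 1 (by decide)
  choose g hg hg' using exists_gen (lfR α) (crn hα)
  have hpt : ∀ {γ : ℂ}, γ ^ 6 + γ ^ 5 + γ ^ 4 + γ ^ 3 + γ ^ 2 + γ + 1 = 0 → ∀ R, ptR γ R ≠ 0 := by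
    intro γ hγ R
    have : ∀ R : Fin 13, ∃ k, k ∉ inc R := by decide
    obtain ⟨k, hk⟩ := this R
    exact ne_of_ev (nin hγ R k hk)
  have hgn : ∀ m, g m ≠ 0 := by
    intro m
    have : ∀ m : Fin 11, ∃ k, k ≠ m := by decide
    obtain ⟨k, hk⟩ := this m
    exact ne_of_ev (hg' m k hk)
  -- proportionality
  have pr : ∀ {γ : ℂ}, γ ^ 6 + γ ^ 5 + γ ^ 4 + γ ^ 3 + γ ^ 2 + γ + 1 = 0 → ∀ R Q m k l,
      ok R Q m k l → l ∉ inc R ∧ rho γ R k l ≠ 0 ∧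
        ∀ v, ev (lfR γ m) v = 0 → ev (lfR γ k) v = rho γ R k l * ev (lfR γ l) v := by
    intro γ hγ R Q m k l ⟨h1, h2, h3, h4, h5, h6, h7⟩
    obtain ⟨r, hr, E⟩ := prop_on (hpt hγ Q) (yin hγ Q m h3) (yin hγ Q k h4) (yin hγ Q l h5)
      (crn hγ m k h6) (crn hγ m l h7)
    have e1 := E _ (yin hγ R m h1)
    have hlR : ev (lfR γ l) (ptR γ R) ≠ 0 := fun h0 => nin hγ R k h2 (by rw [e1, h0, mul_zero])
    have hr' : rho γ R k l = r := by rw [rho, e1, mul_div_cancel_right₀ _ hlR]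
    rw [hr']
    exact ⟨fun hl => hlR (yin hγ R l hl), hr, E⟩
  have hm : ∀ m, ev (lfR α m) (pt (g m)).rep = 0 := fun m => (ev_pt_zero (hgn m) _).2 (hg m)
  have hm' : ∀ m k, k ≠ m → ev (lfR α k) (pt (g m)).rep ≠ 0 :=
    fun m k hk => (ev_pt_ne (hgn m) _).2 (hg' m k hk)
  have X := alg (fun m k => u k (pt (g m))) (fun R k => u k (pt (ptR α R))) (by
    intro R Q m k l hok
    obtain ⟨hl, hr, E⟩ := pr hα R Q m k l hok
    obtain ⟨hl', hr', E'⟩ := pr hβ R Q m k l hok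
    obtain ⟨h1, h2, h3, h4, h5, h6, h7⟩ := hok
    exact P2 m k l _ _ hr E E' _ _ ((ev_pt_zero (hpt hα R) _).2 (yin hα R m h1)) (hm m)
      ((ev_pt_ne (hpt hα R) _).2 (nin hα R k h2)) (hm' m k h6.symm))
  have Y : ∀ R Q m k l, ok R Q m k l → Complex.exp (u k (pt (g m)) - u l (pt (g m))) =
      rho β R k l / rho α R k l ^ ε := by
    intro R Q m k l hok
    obtain ⟨hl, hr, E⟩ := pr hα R Q m k l hok
    obtain ⟨hl', hr', E'⟩ := pr hβ R Q m k l hok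
    obtain ⟨h1, h2, h3, h4, h5, h6, h7⟩ := hok
    have j1 := hm' m k h6.symm
    have j2 := hm' m l h7.symm
    have j3 : ev (lfR β m) (h (pt (g m))).rep = 0 := by
      by_contra hc; exact (hh m _).2 hc (hm m)
    rw [P3 k l _ j1 j2, E _ (hm m), E' _ j3, mul_div_cancel_right₀ _ j2,
      mul_div_cancel_right₀ _ ((hh l _).1 j2)]
  have Z := congrArg Complex.exp X
  simp only [Complex.exp_add] at Z
  rw [Y 0 8 1 7 5 (by decide), Y 9 10 2 10 7 (by decide), Y 12 3 4 7 0 (by decide),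
    Y 2 4 0 9 8 (by decide), Y 3 8 7 5 1 (by decide), Y 8 10 7 10 2 (by decide),
    Y 2 4 0 10 8 (by decide), Y 0 8 1 6 5 (by decide), Y 4 10 10 7 2 (by decide),
    Y 9 7 4 10 1 (by decide), Y 3 12 4 9 6 (by decide), Y 5 1 2 5 0 (by decide)] at Z
  simp only [div_mul_div_comm, ← mul_zpow] at Z
  rw [ident hα, ident hβ] at Z
  have n : ∀ {γ : ℂ}, γ ^ 6 + γ ^ 5 + γ ^ 4 + γ ^ 3 + γ ^ 2 + γ + 1 = 0 →
      rho γ 2 10 8 * rho γ 0 6 5 * rho γ 4 7 2 * rho γ 9 10 1 * rho γ 3 9 6 * rho γ 5 5 0 ≠ 0 := by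
    intro γ hγ
    refine mul_ne_zero (mul_ne_zero (mul_ne_zero (mul_ne_zero (mul_ne_zero ?_ ?_) ?_) ?_) ?_) ?_
    all_goals exact rho_ne hγ _ _ _ (by decide) (by decide)
  have nα := n hα
  have nβ := n hβ
  have h0 : α ≠ 0 := by rintro rfl; norm_num at hα
  generalize rho α 2 10 8 * rho α 0 6 5 * rho α 4 7 2 * rho α 9 10 1 * rho α 3 9 6 * rho α 5 5 0
    = A at Z nα
  generalize rho β 2 10 8 * rho β 0 6 5 * rho β 4 7 2 * rho β 9 10 1 * rho β 3 9 6 * rho β 5 5 0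
    = B at Z nβ
  have nA := zpow_ne_zero ε nα
  have n0 := zpow_ne_zero ε h0
  rw [mul_zpow, div_eq_div_iff (mul_ne_zero n0 nA) nA] at Z
  have W : β = α ^ ε := by
    apply mul_right_cancel₀ (mul_ne_zero nβ nA)
    linear_combination Z
  rcases hε with rfl | rfl
  · left; simpa using W
  · right; simpa using W

/-- For `i ≠ j ∈ {1,…,6}` with `i + j ≢ 0 (mod 7)`, no homeomorphism of `ℂℙ²`
maps each line `L_k` of `N_i` onto the line `L_k` of `N_j`: the arrangements `N_i`
and `N_j` form an ordered Zariski pair. -/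
theorem statement9 (ξ : ℂ) (hξ : ξ^6 + ξ^5 + ξ^4 + ξ^3 + ξ^2 + ξ + 1 = 0)
    (i j : ℕ) (hi : i ∈ Finset.Icc 1 6) (hj : j ∈ Finset.Icc 1 6)
    (hij : i ≠ j) (hmod : ¬ (7 ∣ i + j)) :
    ¬ ∃ h : CP2 ≃ₜ CP2, ∀ k : Fin 11, h '' Nline (ξ^i) k = Nline (ξ^j) k := by
  rintro ⟨h, H⟩
  have hp := prim hξ
  have hpw : ∀ n ∈ Finset.Icc 1 6, (ξ ^ n) ^ 6 + (ξ ^ n) ^ 5 + (ξ ^ n) ^ 4 + (ξ ^ n) ^ 3 +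
      (ξ ^ n) ^ 2 + ξ ^ n + 1 = 0 := by
    intro n hn
    have h1 : ξ ^ n ≠ 1 := by
      intro h0
      have := Nat.le_of_dvd (by grind) (hp.dvd_of_pow_eq_one n h0)
      grind
    apply mul_left_cancel₀ (sub_ne_zero.2 h1)
    have h7 : (ξ ^ n) ^ 7 = 1 := by rw [← pow_mul, mul_comm, pow_mul, hp.pow_eq_one, one_pow]
    linear_combination h7
  rcases final (hpw i hi) (hpw j hj) h H with e | e
  · exact hij (hp.pow_inj (by grind) (by grind) e.symm)
  · apply hmod
    apply hp.dvd_of_pow_eq_one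
    have h0 : ξ ^ i ≠ 0 := pow_ne_zero _ (hp.ne_zero (by norm_num))
    rw [pow_add, e, mul_inv_cancel₀ h0]
end
end

section
/- Let 𝔇 be the following collection of subsets of {1,...,12}: {1,2}, {1,3,6}, {1,4,7}, {1,5,8}, {1,9,10,11,12}, {2,3,9}, {2,4,10}, {2,5,11}, {2,6,7,8}, {3,4,5}, {3,7,12}, {3,8,11}, {3,10}, {4,6,9}, {4,8}, {4,11}, {5,6}, {5,7,10}, {5,9}, {6,10}, {6,11}, {7,9}, {7,11}, {8,9}, {8,10}, {2,12}, {4,12}, {5,12}, {6,12}, {8,12}. Then the only permutation τ of {1,...,12} such that the image under τ of every member of 𝔇 is again a member of 𝔇 is the identity. -/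
/- The combinatorics `𝔇` of the 12-line arrangements `𝔑_i` (lines indexed by
`Fin 12`, line `Lk` corresponding to `(k-1 : Fin 12)`). -/
def fD12 : Finset (Finset (Fin 12)) :=
  {{0, 1},
   {0, 2, 5},
   {0, 3, 6},
   {0, 4, 7},
   {0, 8, 9, 10, 11},
   {1, 2, 8},
   {1, 3, 9},
   {1, 4, 10},
   {1, 5, 6, 7},
   {2, 3, 4},
   {2, 6, 11},
   {2, 7, 10},
   {2, 9},
   {3, 5, 8},
   {3, 7},
   {3, 10},
   {4, 5},
   {4, 6, 9},
   {4, 8},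
   {5, 9},
   {5, 10},
   {6, 8},
   {6, 10},
   {7, 8},
   {7, 9},
   {1, 11},
   {3, 11},
   {4, 11},
   {5, 11},
   {7, 11}}

theorem fD12_deg (τ : Equiv.Perm (Fin 12)) (h : ∀ s ∈ fD12, s.image τ ∈ fD12) (i : Fin 12) (k : ℕ) :
    (fD12.filter (fun s => i ∈ s ∧ s.card = k)).card
      ≤ (fD12.filter (fun s => τ i ∈ s ∧ s.card = k)).card := by
  apply Finset.card_le_card_of_injOn (fun s => s.image τ)
  · intro s hs
    simp only [Finset.coe_filter, Set.mem_setOf_eq] at hs ⊢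
    refine ⟨h s hs.1, Finset.mem_image_of_mem _ hs.2.1, ?_⟩
    rw [Finset.card_image_of_injective _ τ.injective]
    exact hs.2.2
  · intro s _ t _ hst
    exact Finset.image_injective τ.injective hst

set_option maxRecDepth 100000

/-- The only permutation preserving the combinatorics `𝔇` is the identity. -/
theorem statement12 (τ : Equiv.Perm (Fin 12)) (h : ∀ s ∈ fD12, s.image τ ∈ fD12) :
    τ = 1 := by
  have h2 : τ 2 = 2 := by
    have a := le_trans (show 5 ≤ _ by decide) (fD12_deg τ h 2 3)
    have d : ∀ x : Fin 12, 5 ≤ (fD12.filter (fun s => x ∈ s ∧ s.card = 3)).card → x = 2 := by decide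
    exact d _ a
  have h11 : τ 11 = 11 := by
    have a := le_trans (show 5 ≤ _ by decide) (fD12_deg τ h 11 2)
    have d : ∀ x : Fin 12, 5 ≤ (fD12.filter (fun s => x ∈ s ∧ s.card = 2)).card → x = 11 := by decide
    exact d _ a
  have h0 : τ 0 = 0 := by
    have a := le_trans (show 3 ≤ _ by decide) (fD12_deg τ h 0 3)
    have b := le_trans (show 1 ≤ _ by decide) (fD12_deg τ h 0 5)
    have d : ∀ x : Fin 12, 3 ≤ (fD12.filter (fun s => x ∈ s ∧ s.card = 3)).card →
      1 ≤ (fD12.filter (fun s => x ∈ s ∧ s.card = 5)).card → x = 0 := by decide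
    exact d _ a b
  have h5 : τ 5 = 5 := by
    have a := h {0, 2, 5} (by decide)
    simp only [Finset.image_insert, Finset.image_singleton, h0, h2] at a
    have d : ∀ x : Fin 12, ({0, 2, x} : Finset (Fin 12)) ∈ fD12 → x = 5 := by decide
    exact d _ a
  have h6 : τ 6 = 6 := by
    have a := h {2, 6, 11} (by decide)
    simp only [Finset.image_insert, Finset.image_singleton, h2, h11] at a
    have d : ∀ x : Fin 12, ({2, x, 11} : Finset (Fin 12)) ∈ fD12 → x = 6 := by decide
    exact d _ a
  have h3 : τ 3 = 3 := by
    have a := h {0, 3, 6} (by decide)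
    simp only [Finset.image_insert, Finset.image_singleton, h0, h6] at a
    have d : ∀ x : Fin 12, ({0, x, 6} : Finset (Fin 12)) ∈ fD12 → x = 3 := by decide
    exact d _ a
  have h4 : τ 4 = 4 := by
    have a := h {2, 3, 4} (by decide)
    simp only [Finset.image_insert, Finset.image_singleton, h2, h3] at a
    have d : ∀ x : Fin 12, ({2, 3, x} : Finset (Fin 12)) ∈ fD12 → x = 4 := by decide
    exact d _ a
  have h7 : τ 7 = 7 := by
    have a := h {0, 4, 7} (by decide)
    simp only [Finset.image_insert, Finset.image_singleton, h0, h4] at a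
    have d : ∀ x : Fin 12, ({0, 4, x} : Finset (Fin 12)) ∈ fD12 → x = 7 := by decide
    exact d _ a
  have h1 : τ 1 = 1 := by
    have a := h {1, 5, 6, 7} (by decide)
    simp only [Finset.image_insert, Finset.image_singleton, h5, h6, h7] at a
    have d : ∀ x : Fin 12, ({x, 5, 6, 7} : Finset (Fin 12)) ∈ fD12 → x = 1 := by decide
    exact d _ a
  have h8 : τ 8 = 8 := by
    have a := h {1, 2, 8} (by decide)
    simp only [Finset.image_insert, Finset.image_singleton, h1, h2] at a
    have d : ∀ x : Fin 12, ({1, 2, x} : Finset (Fin 12)) ∈ fD12 → x = 8 := by decide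
    exact d _ a
  have h9 : τ 9 = 9 := by
    have a := h {1, 3, 9} (by decide)
    simp only [Finset.image_insert, Finset.image_singleton, h1, h3] at a
    have d : ∀ x : Fin 12, ({1, 3, x} : Finset (Fin 12)) ∈ fD12 → x = 9 := by decide
    exact d _ a
  have h10 : τ 10 = 10 := by
    have a := h {1, 4, 10} (by decide)
    simp only [Finset.image_insert, Finset.image_singleton, h1, h4] at a
    have d : ∀ x : Fin 12, ({1, 4, x} : Finset (Fin 12)) ∈ fD12 → x = 10 := by decide
    exact d _ a
  ext i
  fin_cases i <;> simp [h0, h1, h2, h3, h4, h5, h6, h7, h8, h9, h10, h11]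
end

section
/- Let ζ ∈ ℂ be a root of Z⁴+Z³+Z²+Z+1. For i ∈ {1,2,3,4} set α = ζ^i and let B^i be the arrangement of 11 lines: L1: z=0, L2: (−α−1)x+y=0, L3: x=0, L4: x−z=0, L5: (−α²−α−1)x+z=0, L6: y=0, L7: x+(α³+α²+α+1)y=0, L8: y−z=0, L9: (−α³−α²−α)x+y+(α³+α²+α)z=0, L10: (−α³−α²−α)x+y+(α²+α)z=0, L11: αx−y+z=0. Then for i ≠ j ∈ {1,2,3,4} with i + j ≢ 0 (mod 5), there is no homeomorphism h of ℂℙ² onto itself with h(Z(B^i)) = Z(B^j); thus (B^i, B^j) is a Zariski pair. -/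
/- The complex projective plane `ℂℙ²`, with its quotient topology, and projective
lines given as zero loci of linear forms in the homogeneous coordinates. -/

open scoped LinearAlgebra.Projectivization
open Projectivization

noncomputable section

/-- The lines of the arrangement `B^i` of Appendix B.1, where `α = ζ^i`. -/
def B1line (α : ℂ) : Fin 11 → Set CP2 :=
  ![projLine 0 0 1,
    projLine (-α - 1) 1 0,
    projLine 1 0 0,
    projLine 1 0 (-1),
    projLine (-α^2 - α - 1) 0 1,
    projLine 0 1 0,
    projLine 1 (α^3 + α^2 + α + 1) 0,
    projLine 0 1 (-1),
    projLine (-α^3 - α^2 - α) 1 (α^3 + α^2 + α),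
    projLine (-α^3 - α^2 - α) 1 (α^2 + α),
    projLine α (-1) 1]


lemma zp_exp_const {X : Type*} [TopologicalSpace X] {s : Set X} (hs : IsPreconnected s)
    {f : X → ℂ} (hf : ContinuousOn f s) (k : ℂ) (hk : ∀ x ∈ s, Complex.exp (f x) = k)
    {x y : X} (hx : x ∈ s) (hy : y ∈ s) : f x = f y := by
  have key : ∀ z ∈ s, ∃ n : ℤ, (n : ℂ) = (f z - f x) / (2 * Real.pi * Complex.I) := by
    intro z hz
    have := (hk z hz).trans (hk x hx).symm
    rw [Complex.exp_eq_exp_iff_exists_int] at this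
    obtain ⟨n, hn⟩ := this
    refine ⟨n, ?_⟩
    rw [hn, add_sub_cancel_left, mul_div_cancel_right₀]
    exact Complex.two_pi_I_ne_zero
  have hd : DiscreteTopology (Set.range (Int.cast : ℤ → ℂ)) := by
    have h1 : Topology.IsClosedEmbedding (Int.cast : ℤ → ℂ) := Complex.isClosedEmbedding_intCast
    exact h1.toIsEmbedding.toHomeomorph.discreteTopology
  have := hs.constant_of_mapsTo (f := fun z => (f z - f x) / (2 * Real.pi * Complex.I))
    (T := Set.range (Int.cast : ℤ → ℂ)) ⟨hd⟩ (by fun_prop) (fun z hz => key z hz) hx hy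
  simp only [sub_self, zero_div] at this
  rw [eq_comm, div_eq_zero_iff] at this
  rcases this with h | h
  · exact (sub_eq_zero.mp h).symm
  · exact absurd h Complex.two_pi_I_ne_zero

lemma zp_lemA (F : ℂ × ℂ → ℂ) (hc : ContinuousOn F {p | p.2 ≠ 0})
    (h0 : ∀ p : ℂ × ℂ, p.2 ≠ 0 → F p ≠ 0) :
    ∃ (w : ℤ) (g : ℂ × ℂ → ℂ), ContinuousOn g {p | p.2 ≠ 0} ∧
      ∀ p : ℂ × ℂ, p.2 ≠ 0 → F p = p.2 ^ w * Complex.exp (g p) := by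
  have hG : Continuous (fun p : ℂ × ℂ => F (p.1, Complex.exp p.2)) := by
    apply hc.comp_continuous (by fun_prop)
    intro p; exact Complex.exp_ne_zero _
  obtain ⟨Φ, hΦc, hΦ⟩ := Complex.exists_continuousOn_eqOn_exp_comp (X := ℂ × ℂ) (U := Set.univ)
    (g := fun p : ℂ × ℂ => F (p.1, Complex.exp p.2))
    (by
      have := (convex_univ (𝕜 := ℝ) (E := ℂ × ℂ)).contractibleSpace Set.univ_nonempty
      exact SimplyConnectedSpace.ofContractible _) isOpen_univ hG.continuousOn
    (by rintro ⟨p, -, hp⟩; exact h0 _ (Complex.exp_ne_zero _) hp)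
  have hΦc' : Continuous Φ := by simpa [continuousOn_univ] using hΦc
  have hΦ' : ∀ s t, Complex.exp (Φ (s, t)) = F (s, Complex.exp t) := fun s t => hΦ (Set.mem_univ (s,t))
  have hper : ∀ p : ℂ × ℂ, Complex.exp (Φ (p.1, p.2 + 2 * Real.pi * Complex.I) - Φ p) = 1 := by
    intro p
    rw [Complex.exp_sub, hΦ', show Complex.exp (Φ p) = _ from hΦ' p.1 p.2, Complex.exp_periodic]
    exact div_self (h0 _ (Complex.exp_ne_zero _))
  obtain ⟨w, hw⟩ := Complex.exp_eq_one_iff.mp (hper (0,0))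
  have hw' : ∀ s t, Φ (s, t + 2 * Real.pi * Complex.I) = Φ (s, t) + w * (2 * Real.pi * Complex.I) := by
    intro s t
    have := zp_exp_const (X := ℂ × ℂ) (s := Set.univ) isPreconnected_univ
      (f := fun p => Φ (p.1, p.2 + 2 * Real.pi * Complex.I) - Φ p)
      (by fun_prop) 1 (fun x _ => hper x) (Set.mem_univ (s,t)) (Set.mem_univ (0,0))
    simp only at this hw
    rw [hw] at this
    linear_combination this
  have hwn : ∀ s t (n : ℤ), Φ (s, t + n * (2 * Real.pi * Complex.I)) = Φ (s, t) + n * (w * (2 * Real.pi * Complex.I)) := by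
    intro s t n
    induction n with
    | zero => simp
    | succ n ih =>
      push_cast at ih ⊢
      rw [add_mul, ← add_assoc, one_mul, hw', ih]; ring
    | pred n ih =>
      push_cast at ih ⊢
      have := hw' s (t + (-(n:ℂ) - 1) * (2 * Real.pi * Complex.I))
      rw [show t + (-(n:ℂ) - 1) * (2 * Real.pi * Complex.I) + 2 * Real.pi * Complex.I = t + -n * (2 * Real.pi * Complex.I) by ring, ih] at this
      linear_combination -this
  have hinv : ∀ s t t', Complex.exp t = Complex.exp t' → Φ (s, t) - w * t = Φ (s, t') - w * t' := by
    intro s t t' h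
    obtain ⟨n, hn⟩ := Complex.exp_eq_exp_iff_exists_int.mp h
    rw [hn, hwn]; ring
  refine ⟨w, fun p => Φ (p.1, Complex.log p.2) - w * Complex.log p.2, ?_, ?_⟩
  · intro p hp
    apply ContinuousAt.continuousWithinAt
    have hp : p.2 ≠ 0 := hp
    have h1 : ContinuousAt (fun q : ℂ × ℂ => Complex.log (q.2 / p.2) + Complex.log p.2) p := by
      apply ContinuousAt.add _ continuousAt_const
      apply ContinuousAt.clog
      · fun_prop
      · rw [div_self hp]; exact Complex.one_mem_slitPlane
    have h2 : ContinuousAt (fun q : ℂ × ℂ => Φ (q.1, Complex.log (q.2 / p.2) + Complex.log p.2)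
        - w * (Complex.log (q.2 / p.2) + Complex.log p.2)) p := by
      apply ContinuousAt.sub
      · exact hΦc'.continuousAt.comp (continuousAt_fst.prodMk h1)
      · exact continuousAt_const.mul h1
    apply h2.congr
    have : {q : ℂ × ℂ | q.2 ≠ 0} ∈ nhds p :=
      (isOpen_ne_fun continuous_snd continuous_const).mem_nhds hp
    filter_upwards [this] with q hq
    apply hinv
    have hq : q.2 ≠ 0 := hq
    rw [Complex.exp_add, Complex.exp_log (div_ne_zero hq hp), Complex.exp_log hp, Complex.exp_log hq]
    field_simp
  · intro p hp
    simp only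
    rw [Complex.exp_sub, hΦ', Complex.exp_log hp, Complex.exp_int_mul, Complex.exp_log hp]
    field_simp

/-- winding number zero -/
lemma zp_lemB (n : ℤ) (G : ℝ → ℂ) (hG : Continuous G) (hper : G (2 * Real.pi) = G 0)
    (h : ∀ θ : ℝ, Complex.exp (θ * Complex.I) ^ n = Complex.exp (G θ)) : n = 0 := by
  have := zp_exp_const (X := ℝ) (s := Set.univ) isPreconnected_univ
    (f := fun θ : ℝ => n * (θ * Complex.I) - G θ) (by fun_prop) 1 (by
      intro θ _
      rw [Complex.exp_sub, Complex.exp_int_mul, h, div_self (Complex.exp_ne_zero _)])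
      (Set.mem_univ (2 * Real.pi)) (Set.mem_univ 0)
  simp only [hper] at this
  have h2 : (n:ℂ) * (2 * Real.pi * Complex.I) = 0 := by
    push_cast at this
    linear_combination this
  rcases mul_eq_zero.mp h2 with h | h
  · exact_mod_cast h
  · exact absurd h Complex.two_pi_I_ne_zero

def zlf (a v : Fin 3 → ℂ) : ℂ := a 0 * v 0 + a 1 * v 1 + a 2 * v 2

def zcr (a b : Fin 3 → ℂ) : Fin 3 → ℂ :=
  ![a 1 * b 2 - a 2 * b 1, a 2 * b 0 - a 0 * b 2, a 0 * b 1 - a 1 * b 0]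

def zPL (a : Fin 3 → ℂ) : Set CP2 := {p | zlf a p.rep = 0}

def zrat (a b : Fin 3 → ℂ) (p : CP2) : ℂ := zlf a p.rep / zlf b p.rep

lemma zlf_smul (a v : Fin 3 → ℂ) (c : ℂ) : zlf a (c • v) = c * zlf a v := by
  simp [zlf]; ring

lemma zlf_add (a v w : Fin 3 → ℂ) : zlf a (v + w) = zlf a v + zlf a w := by
  simp [zlf]; ring

lemma zlf_cont (a : Fin 3 → ℂ) : Continuous (zlf a) := by
  unfold zlf; fun_prop

lemma zlf_rep_mk (v : Fin 3 → ℂ) (hv : v ≠ 0) :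
    ∃ c : ℂ, c ≠ 0 ∧ ∀ a, zlf a (Projectivization.mk ℂ v hv).rep = c * zlf a v := by
  obtain ⟨c, hc⟩ := Projectivization.exists_smul_eq_mk_rep ℂ v hv
  refine ⟨c, c.ne_zero, fun a => ?_⟩
  rw [← hc, ← zlf_smul]; rfl

lemma zPL_mk (a v : Fin 3 → ℂ) (hv : v ≠ 0) :
    Projectivization.mk ℂ v hv ∈ zPL a ↔ zlf a v = 0 := by
  obtain ⟨c, hc, h⟩ := zlf_rep_mk v hv
  simp [zPL, h, hc]

lemma zrat_mk (a b v : Fin 3 → ℂ) (hv : v ≠ 0) :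
    zrat a b (Projectivization.mk ℂ v hv) = zlf a v / zlf b v := by
  obtain ⟨c, hc, h⟩ := zlf_rep_mk v hv
  simp only [zrat, h]
  rw [mul_div_mul_left _ _ hc]

lemma zcont_mk {X : Type*} [TopologicalSpace X] (f : X → Fin 3 → ℂ) (hf : Continuous f)
    (h0 : ∀ x, f x ≠ 0) : Continuous (fun x => (Projectivization.mk ℂ (f x) (h0 x) : CP2)) := by
  have : Continuous (fun x => (⟨f x, h0 x⟩ : {v : Fin 3 → ℂ // v ≠ 0})) := hf.subtype_mk h0
  exact continuous_quotient_mk'.comp this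

lemma zquot_open : IsOpenQuotientMap
    (fun v : {v : Fin 3 → ℂ // v ≠ 0} => (Projectivization.mk ℂ v.1 v.2 : CP2)) := by
  have hq : Topology.IsQuotientMap
      (fun v : {v : Fin 3 → ℂ // v ≠ 0} => (Projectivization.mk ℂ v.1 v.2 : CP2)) :=
    isQuotientMap_quotient_mk' (s := projectivizationSetoid ℂ (Fin 3 → ℂ))
  refine ⟨hq.surjective, hq.continuous, fun U hU => ?_⟩
  rw [← hq.isOpen_preimage]
  have hU2 : (fun v : {v : Fin 3 → ℂ // v ≠ 0} => (Projectivization.mk ℂ v.1 v.2 : CP2)) ⁻¹'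
      ((fun v : {v : Fin 3 → ℂ // v ≠ 0} => (Projectivization.mk ℂ v.1 v.2 : CP2)) '' U) =
      ⋃ c : ℂˣ, (fun v : {v : Fin 3 → ℂ // v ≠ 0} =>
        (⟨(c : ℂ) • v.1, smul_ne_zero c.ne_zero v.2⟩ : {v : Fin 3 → ℂ // v ≠ 0})) ⁻¹' U := by
    ext v
    simp only [Set.mem_preimage, Set.mem_image, Set.mem_iUnion]
    constructor
    · rintro ⟨u, hu, h⟩
      obtain ⟨c, hc⟩ := (Projectivization.mk_eq_mk_iff ℂ _ _ _ _).mp h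
      refine ⟨c, ?_⟩
      convert hu
      exact hc
    · rintro ⟨c, hc⟩
      exact ⟨_, hc, (Projectivization.mk_eq_mk_iff ℂ _ _ _ _).mpr ⟨c, rfl⟩⟩
  rw [hU2]
  apply isOpen_iUnion
  intro c
  exact hU.preimage ((continuous_subtype_val.const_smul (c : ℂ)).subtype_mk _)

lemma zPL_closed (a : Fin 3 → ℂ) : IsClosed (zPL a) := by
  rw [← zquot_open.isQuotientMap.isClosed_preimage]
  have : (fun v : {v : Fin 3 → ℂ // v ≠ 0} => (Projectivization.mk ℂ v.1 v.2 : CP2)) ⁻¹' zPL a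
      = {v | zlf a v.1 = 0} := by
    ext v; exact zPL_mk a v.1 v.2
  rw [this]
  exact isClosed_eq ((zlf_cont a).comp continuous_subtype_val) continuous_const

lemma zrat_contAt (a b : Fin 3 → ℂ) {p : CP2} (hp : p ∉ zPL b) : ContinuousAt (zrat a b) p := by
  obtain ⟨v, rfl⟩ := zquot_open.surjective p
  rw [← zquot_open.continuousAt_comp_iff]
  have h1 : (zrat a b) ∘ (fun v : {v : Fin 3 → ℂ // v ≠ 0} => (Projectivization.mk ℂ v.1 v.2 : CP2))
    = fun v => zlf a v.1 / zlf b v.1 := by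
    ext v; exact zrat_mk a b v.1 v.2
  rw [h1]
  apply ContinuousAt.div
  · exact ((zlf_cont a).comp continuous_subtype_val).continuousAt
  · exact ((zlf_cont b).comp continuous_subtype_val).continuousAt
  · rwa [zPL_mk] at hp

lemma zcramer (a b m v : Fin 3 → ℂ) :
    zlf a v • zcr b m + zlf b v • zcr m a + zlf m v • zcr a b = zlf m (zcr a b) • v := by
  ext i; fin_cases i <;> simp [zlf, zcr] <;> ring

lemma zlf_rot (a b m : Fin 3 → ℂ) : zlf a (zcr b m) = zlf m (zcr a b) := by
  simp [zlf, zcr]; ring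
lemma zlf_rot' (a b m : Fin 3 → ℂ) : zlf b (zcr m a) = zlf m (zcr a b) := by
  simp [zlf, zcr]; ring
lemma zlf_l (a b : Fin 3 → ℂ) : zlf a (zcr a b) = 0 := by
  simp [zlf, zcr]; ring
lemma zlf_r (a b : Fin 3 → ℂ) : zlf b (zcr a b) = 0 := by
  simp [zlf, zcr]; ring

lemma zmk_rep (p : CP2) (v : Fin 3 → ℂ) (hv : v ≠ 0) (c : ℂ) (h : v = c • p.rep) :
    Projectivization.mk ℂ v hv = p := by
  have hc : c ≠ 0 := by rintro rfl; simp at h; exact hv h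
  conv_rhs => rw [← p.mk_rep]
  rw [Projectivization.mk_eq_mk_iff']
  exact ⟨c, h.symm⟩

lemma zexists_m {v : Fin 3 → ℂ} (hv : v ≠ 0) : ∃ m, zlf m v ≠ 0 := by
  by_contra! h
  apply hv
  ext i
  have := h (Pi.single i 1)
  fin_cases i <;> simpa [zlf] using this

lemma zinter {a c : Fin 3 → ℂ} (h : zcr a c ≠ 0) {p : CP2} (ha : p ∈ zPL a) (hc : p ∈ zPL c) :
    p = Projectivization.mk ℂ (zcr a c) h := by
  obtain ⟨m, hm⟩ := zexists_m h
  have h1 := zcramer a c m p.rep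
  have ha : zlf a p.rep = 0 := ha
  have hc : zlf c p.rep = 0 := hc
  rw [ha, hc, zero_smul, zero_smul, zero_add, zero_add] at h1
  symm
  have hmp : zlf m p.rep ≠ 0 := by
    intro h0
    rw [h0, zero_smul] at h1
    exact (smul_ne_zero hm p.rep_nonzero) h1.symm
  apply zmk_rep _ _ _ ((zlf m p.rep)⁻¹ * zlf m (zcr a c))
  rw [mul_smul, ← h1, smul_smul, inv_mul_cancel₀ hmp, one_smul]

lemma zinter_fin {a c : Fin 3 → ℂ} (h : zcr a c ≠ 0) : (zPL a ∩ zPL c).Finite := by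
  apply Set.Subsingleton.finite
  intro p hp q hq
  rw [zinter h hp.1 hp.2, zinter h hq.1 hq.2]

/-- param of the line `a`, minus its point on `c`. -/
lemma zparam {a c m : Fin 3 → ℂ} (hD : zlf m (zcr a c) ≠ 0) :
    ∃ f : ℂ → CP2, Continuous f ∧ Function.Injective f ∧ Set.range f = zPL a \ zPL c := by
  have hc : ∀ t : ℂ, zlf c (zcr m a + t • zcr a c) = zlf m (zcr a c) := by
    intro t; rw [zlf_add, zlf_smul, zlf_rot', zlf_r]; ring
  have hm : ∀ t : ℂ, zlf m (zcr m a + t • zcr a c) = t * zlf m (zcr a c) := by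
    intro t; rw [zlf_add, zlf_smul, zlf_l]; ring
  have ha : ∀ t : ℂ, zlf a (zcr m a + t • zcr a c) = 0 := by
    intro t; rw [zlf_add, zlf_smul, zlf_l, zlf_r]; ring
  have h0 : ∀ t : ℂ, zcr m a + t • zcr a c ≠ 0 := by
    intro t h
    have := hc t
    rw [h] at this
    apply hD; rw [← this]; simp [zlf]
  refine ⟨fun t => Projectivization.mk ℂ (zcr m a + t • zcr a c) (h0 t),
    zcont_mk _ (by fun_prop) h0, ?_, ?_⟩
  · intro t t' h
    have := congrArg (zrat m c) h
    simp only [zrat_mk, hc, hm] at this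
    rwa [mul_div_cancel_right₀ _ hD, mul_div_cancel_right₀ _ hD] at this
  · ext p
    constructor
    · rintro ⟨t, rfl⟩
      refine ⟨?_, ?_⟩
      · rw [zPL_mk, ha]
      · rw [zPL_mk, hc]; exact hD
    · rintro ⟨hpa, hpc⟩
      have hpa : zlf a p.rep = 0 := hpa
      have hpc : zlf c p.rep ≠ 0 := hpc
      refine ⟨zlf m p.rep / zlf c p.rep, ?_⟩
      apply zmk_rep _ _ _ ((zlf c p.rep)⁻¹ * zlf m (zcr a c))
      have h1 := zcramer a c m p.rep
      rw [hpa, zero_smul, zero_add] at h1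
      rw [mul_smul, ← h1, smul_add, smul_smul, smul_smul, inv_mul_cancel₀ hpc, one_smul,
        div_eq_inv_mul]

lemma zlineconn {a c : Fin 3 → ℂ} (hac : zcr a c ≠ 0) {T : Set CP2} (hT : zPL a ∩ zPL c ⊆ T)
    (hfin : (T ∩ zPL a).Finite) : IsPreconnected (zPL a \ T) := by
  obtain ⟨m, hm⟩ := zexists_m hac
  obtain ⟨f, hf, hinj, hr⟩ := zparam hm
  have : zPL a \ T = f '' ((f ⁻¹' (T ∩ zPL a))ᶜ) := by
    ext p
    constructor
    · rintro ⟨h1, h2⟩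
      have : p ∈ Set.range f := by
        rw [hr]; exact ⟨h1, fun h => h2 (hT ⟨h1, h⟩)⟩
      obtain ⟨t, rfl⟩ := this
      exact ⟨t, fun h => h2 h.1, rfl⟩
    · rintro ⟨t, ht, rfl⟩
      have : f t ∈ zPL a \ zPL c := hr ▸ Set.mem_range_self t
      exact ⟨this.1, fun h => ht ⟨h, this.1⟩⟩
  rw [this]
  apply IsPreconnected.image _ _ hf.continuousOn
  have hfin2 : (f ⁻¹' (T ∩ zPL a)).Finite := hfin.preimage hinj.injOn
  exact (hfin2.countable.isConnected_compl_of_one_lt_rank (by simp)).isPreconnected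

lemma zdense1 {a c m : Fin 3 → ℂ} (hD : zlf m (zcr a c) ≠ 0) {T : Set CP2}
    (hfin : (T ∩ zPL a).Finite) : zPL a \ zPL c ⊆ closure (zPL a \ T) := by
  obtain ⟨f, hf, hinj, hr⟩ := zparam hD
  have hfin2 : (f ⁻¹' (T ∩ zPL a)).Finite := hfin.preimage hinj.injOn
  have hd : Dense ((f ⁻¹' (T ∩ zPL a))ᶜ) := hfin2.countable.dense_compl ℝ
  rw [← hr]
  refine (hf.range_subset_closure_image_dense hd).trans (closure_mono ?_)
  rintro _ ⟨t, ht, rfl⟩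
  have : f t ∈ zPL a \ zPL c := hr ▸ Set.mem_range_self t
  exact ⟨this.1, fun h => ht ⟨h, this.1⟩⟩

lemma zdense {a c : Fin 3 → ℂ} (hac : zcr a c ≠ 0) {T : Set CP2}
    (hfin : (T ∩ zPL a).Finite) : zPL a ⊆ closure (zPL a \ T) := by
  obtain ⟨m, hm⟩ := zexists_m hac
  intro p hp
  by_cases hc : p ∈ zPL c
  · have hm' : zlf c (zcr a m) ≠ 0 := by
      rw [show zlf c (zcr a m) = - zlf m (zcr a c) by simp [zlf, zcr]; ring]
      exact neg_ne_zero.mpr hm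
    refine zdense1 hm' hfin ⟨hp, ?_⟩
    rw [zinter hac hp hc, zPL_mk]; exact hm
  · exact zdense1 hm hfin ⟨hp, hc⟩

lemma zcover {ι : Type*} [Finite ι] {a c : Fin 3 → ℂ} (hac : zcr a c ≠ 0) (A : ι → Set CP2)
    (hcl : ∀ i, IsClosed (A i)) (hfin : ∀ i j, i ≠ j → (A i ∩ A j).Finite)
    (hcov : zPL a ⊆ ⋃ i, A i) : ∃ i, zPL a ⊆ A i := by
  set T : Set CP2 := (zPL a ∩ zPL c) ∪ ⋃ x : {x : ι × ι // x.1 ≠ x.2}, (A x.1.1 ∩ A x.1.2) with hTdef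
  have hTfin : T.Finite := (zinter_fin hac).union (Set.finite_iUnion fun x => hfin _ _ x.2)
  have hTfin' : (T ∩ zPL a).Finite := hTfin.subset Set.inter_subset_left
  have hconn := zlineconn hac (T := T) Set.subset_union_left hTfin'
  have hd := zdense hac hTfin'
  have hne : (zPL a \ T).Nonempty := by
    have h1 : (zPL a).Nonempty := ⟨Projectivization.mk ℂ (zcr a c) hac, by rw [zPL_mk, zlf_l]⟩
    obtain ⟨p, hp⟩ := h1
    exact closure_nonempty_iff.mp ⟨p, hd hp⟩
  obtain ⟨x, hx⟩ := hne
  obtain ⟨i, hi⟩ := Set.mem_iUnion.mp (hcov hx.1)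
  refine ⟨i, hd.trans ?_⟩
  refine closure_minimal ?_ (hcl i)
  have := (isPreconnected_iff_subset_of_disjoint_closed.mp hconn) (A i) (⋃ j : {j // j ≠ i}, A j) (hcl i)
    (isClosed_iUnion_of_finite fun j => hcl j) ?_ ?_
  · rcases this with h | h
    · exact h
    · exfalso
      obtain ⟨j, hj⟩ := Set.mem_iUnion.mp (h hx)
      exact hx.2 (Or.inr (Set.mem_iUnion.mpr ⟨⟨(j.1, i), j.2⟩, hj, hi⟩))
  · intro y hy
    obtain ⟨j, hj⟩ := Set.mem_iUnion.mp (hcov hy.1)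
    by_cases hji : j = i
    · left; exact hji ▸ hj
    · right; exact Set.mem_iUnion.mpr ⟨⟨j, hji⟩, hj⟩
  · ext y
    simp only [Set.mem_inter_iff, Set.mem_empty_iff_false, iff_false]
    rintro ⟨hy, h1, h2⟩
    obtain ⟨j, hj⟩ := Set.mem_iUnion.mp h2
    exact hy.2 (Or.inr (Set.mem_iUnion.mpr ⟨⟨(j.1, i), j.2⟩, hj, h1⟩))

lemma ztransfer {a b m : Fin 3 → ℂ} (hD : zlf m (zcr a b) ≠ 0) (F : CP2 → ℂ)
    (hF : ContinuousOn F (zPL a ∪ zPL b)ᶜ) (hF0 : ∀ p, p ∉ zPL a → p ∉ zPL b → F p ≠ 0) :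
    ∃ (w : ℤ) (g : CP2 → ℂ), ContinuousOn g (zPL a ∪ zPL b)ᶜ ∧
      ∀ p, p ∉ zPL a → p ∉ zPL b → F p = zrat a b p ^ w * Complex.exp (g p) := by
  let V : ℂ × ℂ → Fin 3 → ℂ := fun q => q.2 • zcr b m + zcr m a + q.1 • zcr a b
  have hVa : ∀ q, zlf a (V q) = q.2 * zlf m (zcr a b) := by
    intro q; simp only [V]; rw [zlf_add, zlf_add, zlf_smul, zlf_smul, zlf_l, zlf_r, zlf_rot]; ring
  have hVb : ∀ q, zlf b (V q) = zlf m (zcr a b) := by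
    intro q; simp only [V]; rw [zlf_add, zlf_add, zlf_smul, zlf_smul, zlf_l, zlf_r, zlf_rot']; ring
  have hV0 : ∀ q, V q ≠ 0 := by
    intro q h
    have := hVb q
    rw [h] at this
    apply hD; rw [← this]; simp [zlf]
  let f : ℂ × ℂ → CP2 := fun q => Projectivization.mk ℂ (V q) (hV0 q)
  have hf : Continuous f := zcont_mk V (by fun_prop) hV0
  have hfa : ∀ q, q.2 ≠ 0 → f q ∉ zPL a := by
    intro q hq; simp only [f]; rw [zPL_mk, hVa]; exact mul_ne_zero hq hD
  have hfb : ∀ q, f q ∉ zPL b := by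
    intro q; simp only [f]; rw [zPL_mk, hVb]; exact hD
  obtain ⟨w, g, hg, h⟩ := zp_lemA (F ∘ f) (by
    apply hF.comp hf.continuousOn
    rintro q hq (h | h)
    · exact hfa q hq h
    · exact hfb q h) (fun q hq => hF0 _ (hfa q hq) (hfb q))
  have hinv : ∀ p, p ∉ zPL b → f (zrat m b p, zrat a b p) = p := by
    intro p hp
    have hp : zlf b p.rep ≠ 0 := hp
    apply zmk_rep _ _ _ ((zlf b p.rep)⁻¹ * zlf m (zcr a b))
    rw [mul_smul, ← zcramer, smul_add, smul_add, smul_smul, smul_smul, smul_smul,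
      inv_mul_cancel₀ hp, one_smul]
    simp only [V, zrat, div_eq_inv_mul]
  have hr : ∀ p, p ∉ zPL a → p ∉ zPL b → zrat a b p ≠ 0 := fun p h1 h2 => div_ne_zero h1 h2
  refine ⟨w, fun p => g (zrat m b p, zrat a b p), ?_, ?_⟩
  · apply hg.comp (t := {p : ℂ × ℂ | p.2 ≠ 0}) (f := fun p => (zrat m b p, zrat a b p))
    · intro p hp
      have hp2 : p ∉ zPL b := fun h => hp (Or.inr h)
      exact ((zrat_contAt m b hp2).prodMk (zrat_contAt a b hp2)).continuousWithinAt
    · intro p hp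
      exact hr p (fun h => hp (Or.inl h)) (fun h => hp (Or.inr h))
  · intro p h1 h2
    have := h (zrat m b p, zrat a b p) (hr p h1 h2)
    simp only [Function.comp, hinv p h2] at this
    exact this

/-- loop lemma: forms `b, c, d` independent; `(lb)^n` has no log off `b,c,d` -/
lemma zloop {a b m : Fin 3 → ℂ} (hD : zlf m (zcr a b) ≠ 0) (n : ℤ) (G : CP2 → ℂ)
    (hG : ContinuousOn G (zPL a ∪ zPL b ∪ zPL m)ᶜ)
    (h : ∀ p, p ∉ zPL a → p ∉ zPL b → p ∉ zPL m → zrat m a p = 1 →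
      zrat a b p ^ n = Complex.exp (G p)) : n = 0 := by
  let V : ℝ → Fin 3 → ℂ := fun θ => Complex.exp (θ * Complex.I) • zcr b m + zcr m a
    + Complex.exp (θ * Complex.I) • zcr a b
  have hVa : ∀ q, zlf a (V q) = Complex.exp (q * Complex.I) * zlf m (zcr a b) := by
    intro q; simp only [V]; rw [zlf_add, zlf_add, zlf_smul, zlf_smul, zlf_l, zlf_r, zlf_rot]; ring
  have hVm : ∀ q, zlf m (V q) = Complex.exp (q * Complex.I) * zlf m (zcr a b) := by
    intro q; simp only [V]; rw [zlf_add, zlf_add, zlf_smul, zlf_smul, zlf_l, zlf_r]; ring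
  have hVb : ∀ q, zlf b (V q) = zlf m (zcr a b) := by
    intro q; simp only [V]; rw [zlf_add, zlf_add, zlf_smul, zlf_smul, zlf_l, zlf_r, zlf_rot']; ring
  have hV0 : ∀ q, V q ≠ 0 := by
    intro q h
    have := hVb q
    rw [h] at this
    apply hD; rw [← this]; simp [zlf]
  have hVper : V (2 * Real.pi) = V 0 := by
    simp only [V]
    push_cast
    rw [Complex.exp_two_pi_mul_I]; simp
  let f : ℝ → CP2 := fun q => Projectivization.mk ℂ (V q) (hV0 q)
  have hf : Continuous f := zcont_mk V (by fun_prop) hV0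
  have hfa : ∀ q, f q ∉ zPL a := by
    intro q; simp only [f]; rw [zPL_mk, hVa]; exact mul_ne_zero (Complex.exp_ne_zero _) hD
  have hfm : ∀ q, f q ∉ zPL m := by
    intro q; simp only [f]; rw [zPL_mk, hVm]; exact mul_ne_zero (Complex.exp_ne_zero _) hD
  have hfb : ∀ q, f q ∉ zPL b := by
    intro q; simp only [f]; rw [zPL_mk, hVb]; exact hD
  apply zp_lemB n (G ∘ f)
  · apply hG.comp_continuous hf
    rintro q ((h | h) | h)
    · exact hfa q h
    · exact hfb q h
    · exact hfm q h
  · simp only [Function.comp, f]; congr 2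
  · intro θ
    have := h (f θ) (hfa θ) (hfb θ) (hfm θ) (by
      simp only [f]; rw [zrat_mk, hVa, hVm, div_self]
      exact mul_ne_zero (Complex.exp_ne_zero _) hD)
    simp only [Function.comp]
    rw [← this]
    simp only [f]; rw [zrat_mk, hVa, hVb, mul_div_cancel_right₀ _ hD]

abbrev ZQ := ℤ × ℤ × ℤ × ℤ

def zqmul : ZQ → ZQ → ZQ
  | (a, b, c, d), (e, f, g, h) =>
    let p4 := b*h + c*g + d*f
    (a*e - p4 + (c*h + d*g), a*f + b*e - p4 + d*h, a*g + b*f + c*e - p4, a*h + b*g + c*f + d*e - p4)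

def zqadd : ZQ → ZQ → ZQ
  | (a, b, c, d), (e, f, g, h) => (a+e, b+f, c+g, d+h)

def zqsub : ZQ → ZQ → ZQ
  | (a, b, c, d), (e, f, g, h) => (a-e, b-f, c-g, d-h)

def zev (α : ℂ) : ZQ → ℂ
  | (a, b, c, d) => a + b * α + c * α^2 + d * α^3

def zpr (α : ℂ) : Prop := α^4 + α^3 + α^2 + α + 1 = 0

lemma zev_mul {α : ℂ} (h : zpr α) (s t : ZQ) : zev α (zqmul s t) = zev α s * zev α t := by
  obtain ⟨a, b, c, d⟩ := s
  obtain ⟨e, f, g, k⟩ := t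
  unfold zpr at h
  simp only [zev, zqmul]
  push_cast
  linear_combination (-((b:ℂ)*k + c*g + d*f) - (c*k+d*g) * (α - 1) - d*k*(α^2-α)) * h

lemma zev_add (α : ℂ) (s t : ZQ) : zev α (zqadd s t) = zev α s + zev α t := by
  obtain ⟨a, b, c, d⟩ := s
  obtain ⟨e, f, g, k⟩ := t
  simp only [zev, zqadd]
  push_cast
  ring

lemma zev_sub (α : ℂ) (s t : ZQ) : zev α (zqsub s t) = zev α s - zev α t := by
  obtain ⟨a, b, c, d⟩ := s
  obtain ⟨e, f, g, k⟩ := t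
  simp only [zev, zqsub]
  push_cast
  ring

lemma zpr_prim {α : ℂ} (h : zpr α) : IsPrimitiveRoot α 5 := by
  have h5 : α ^ 5 = 1 := by
    unfold zpr at h; linear_combination (α - 1) * h
  have h1 : α ≠ 1 := by
    rintro rfl; unfold zpr at h; norm_num at h
  have : Fact (Nat.Prime 5) := ⟨by norm_num⟩
  rw [IsPrimitiveRoot.iff_orderOf]
  exact orderOf_eq_prime h5 h1

lemma zprim_pr {α : ℂ} (h : IsPrimitiveRoot α 5) : zpr α := by
  have h1 : α - 1 ≠ 0 := sub_ne_zero.mpr (h.ne_one (by norm_num))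
  apply mul_left_cancel₀ h1
  linear_combination h.pow_eq_one

lemma zev_eq_zero {α : ℂ} (h : zpr α) (t : ZQ) : zev α t = 0 ↔ t = (0, 0, 0, 0) := by
  constructor
  · obtain ⟨a, b, c, d⟩ := t
    intro h0
    have hp := zpr_prim h
    have hm := Polynomial.cyclotomic_eq_minpoly_rat hp (by norm_num)
    open Polynomial in
    let P : ℚ[X] := C (a : ℚ) + C (b : ℚ) * X + C (c : ℚ) * X ^ 2 + C (d : ℚ) * X ^ 3
    have hP0 : Polynomial.aeval α P = 0 := by
      simp only [P, map_add, map_mul, Polynomial.aeval_C, Polynomial.aeval_X, map_pow]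
      simpa [zev] using h0
    have hPz : P = 0 := by
      by_contra hne
      have h1 := Polynomial.natDegree_le_natDegree (minpoly.degree_le_of_ne_zero ℚ α hne hP0)
      rw [← hm, Polynomial.natDegree_cyclotomic] at h1
      have h2 : P.natDegree ≤ 3 := by
        simp only [P]; compute_degree
      have h3 : Nat.totient 5 = 4 := by decide
      omega
    have hco : ∀ n, P.coeff n = 0 := by intro n; rw [hPz]; simp
    have e0 := hco 0
    have e1 := hco 1
    have e2 := hco 2
    have e3 := hco 3
    simp only [P, Polynomial.coeff_add, Polynomial.coeff_C_mul, Polynomial.coeff_X,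
      Polynomial.coeff_X_pow, Polynomial.coeff_C] at e0 e1 e2 e3
    norm_num at e0 e1 e2 e3
    simp [e0, e1, e2, e3]
  · rintro rfl; simp [zev]

def zqcoef : Fin 11 → Fin 3 → ZQ :=
  ![![(0,0,0,0), (0,0,0,0), (1,0,0,0)],
    ![(-1,-1,0,0), (1,0,0,0), (0,0,0,0)],
    ![(1,0,0,0), (0,0,0,0), (0,0,0,0)],
    ![(1,0,0,0), (0,0,0,0), (-1,0,0,0)],
    ![(-1,-1,-1,0), (0,0,0,0), (1,0,0,0)],
    ![(0,0,0,0), (1,0,0,0), (0,0,0,0)],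
    ![(1,0,0,0), (1,1,1,1), (0,0,0,0)],
    ![(0,0,0,0), (1,0,0,0), (-1,0,0,0)],
    ![(0,-1,-1,-1), (1,0,0,0), (0,1,1,1)],
    ![(0,-1,-1,-1), (1,0,0,0), (0,1,1,0)],
    ![(0,1,0,0), (-1,0,0,0), (1,0,0,0)]]

def zcoef (α : ℂ) (k : Fin 11) (i : Fin 3) : ℂ := zev α (zqcoef k i)

lemma zB1line (α : ℂ) (k : Fin 11) : B1line α k = zPL (zcoef α k) := by
  ext p
  fin_cases k <;> simp [B1line, projLine, zPL, zlf, zcoef, zqcoef, zev] <;> ring_nf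

def zqdet (i j k : Fin 11) : ZQ :=
  let a := zqcoef i
  let b := zqcoef j
  let c := zqcoef k
  zqadd (zqadd (zqmul (c 0) (zqsub (zqmul (a 1) (b 2)) (zqmul (a 2) (b 1))))
    (zqmul (c 1) (zqsub (zqmul (a 2) (b 0)) (zqmul (a 0) (b 2)))))
    (zqmul (c 2) (zqsub (zqmul (a 0) (b 1)) (zqmul (a 1) (b 0))))

lemma zqdet_ev {α : ℂ} (h : zpr α) (i j k : Fin 11) :
    zev α (zqdet i j k) = zlf (zcoef α k) (zcr (zcoef α i) (zcoef α j)) := by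
  simp only [zqdet, zev_add, zev_mul h, zev_sub, zlf, zcr, zcoef]
  simp

def zcon (i j k : Fin 11) : Bool := decide (zqdet i j k = (0, 0, 0, 0))

lemma zcon_iff {α : ℂ} (h : zpr α) (i j k : Fin 11) :
    zcon i j k = true ↔ zlf (zcoef α k) (zcr (zcoef α i) (zcoef α j)) = 0 := by
  rw [← zqdet_ev h, zev_eq_zero h, zcon, decide_eq_true_iff]

/-- the same, from the list of multiple points (as bit masks) -/
def zconT (i j k : Fin 11) : Bool :=
  i == j || j == k || i == k ||
    ([29, 102, 161, 1089, 769, 1034, 530, 386, 1156, 296, 1296, 704] : List ℕ).any (fun m => m.testBit i && m.testBit j && m.testBit k)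

lemma zconT_eq : ∀ i j k : Fin 11, zcon i j k = zconT i j k := by
  decide +kernel

lemma zcon_pair : ∀ i j : Fin 11, i ≠ j → ∃ k, zcon i j k = false := by
  simp only [zconT_eq]
  decide +kernel

lemma zcr_ne {α : ℂ} (h : zpr α) {i j : Fin 11} (hij : i ≠ j) :
    zcr (zcoef α i) (zcoef α j) ≠ 0 := by
  intro h0
  obtain ⟨k, hk⟩ := zcon_pair i j hij
  have : zcon i j k = true := by
    rw [zcon_iff h, h0]; simp [zlf]
  rw [hk] at this; exact absurd this (by simp)

lemma zcon_self : ∀ i k : Fin 11, zcon i i k = true := by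
  simp only [zconT_eq]
  decide +kernel

def zN (k : Fin 11) : ℕ := (Finset.univ.filter (fun x : Fin 11 × Fin 11 => zcon k x.1 x.2 = true)).card

def zV : Fin 11 → ℕ := ![43, 43, 45, 41, 41, 41, 41, 39, 39, 37, 39]

lemma zN_val : ∀ k, zN k = zV k := by
  simp only [zN, zconT_eq]
  decide +kernel

lemma zsig_id (σ : Equiv.Perm (Fin 11)) (hσ : ∀ i j k, zcon (σ i) (σ j) (σ k) = zcon i j k) :
    ∀ i, σ i = i := by
  have hN : ∀ k, zN (σ k) = zN k := by
    intro k
    symm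
    apply Finset.card_equiv (σ.prodCongr σ)
    intro x
    simp [hσ]
  simp only [zN_val] at hN
  simp only [zconT_eq] at hσ
  have h2 : σ 2 = 2 := (by decide +kernel : ∀ x, zV x = zV 2 → x = 2) _ (hN 2)
  have h9 : σ 9 = 9 := (by decide +kernel : ∀ x, zV x = zV 9 → x = 9) _ (hN 9)
  have H : ∀ i j : Fin 11, i ≠ j → σ i ≠ σ j := fun i j h h' => h (σ.injective h')
  have h08 := (by decide +kernel : ∀ x y, zV x = zV 0 → zV y = zV 8 → zconT x y 9 = zconT 0 8 9 → x = 0 ∧ y = 8)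
    (σ 0) (σ 8) (hN _) (hN _) (by simpa [h9] using hσ 0 8 9)
  have h14 := (by decide +kernel : ∀ x y, zV x = zV 1 → zV y = zV 4 → zconT x y 9 = zconT 1 4 9 → x = 1 ∧ y = 4)
    (σ 1) (σ 4) (hN _) (hN _) (by simpa [h9] using hσ 1 4 9)
  have h67 := (by decide +kernel : ∀ x y, zV x = zV 6 → zV y = zV 7 → zconT x y 9 = zconT 6 7 9 → x = 6 ∧ y = 7)
    (σ 6) (σ 7) (hN _) (hN _) (by simpa [h9] using hσ 6 7 9)
  have h10 := (by decide +kernel : ∀ x, zV x = zV 10 → x ≠ 7 → x ≠ 8 → x = 10) (σ 10) (hN _)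
    (by rw [← h67.2]; exact H _ _ (by decide)) (by rw [← h08.2]; exact H _ _ (by decide))
  have h3 := (by decide +kernel : ∀ x, zV x = zV 3 → x ≠ 4 → zconT 0 2 x = zconT 0 2 3 → x = 3) (σ 3) (hN _)
    (by rw [← h14.2]; exact H _ _ (by decide)) (by simpa [h2, h08.1] using hσ 0 2 3)
  have h5 := (by decide +kernel : ∀ x, zV x = zV 5 → x ≠ 3 → x ≠ 4 → x ≠ 6 → x = 5) (σ 5) (hN _)
    (by rw [← h3]; exact H _ _ (by decide)) (by rw [← h14.2]; exact H _ _ (by decide))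
    (by rw [← h67.1]; exact H _ _ (by decide))
  intro i
  fin_cases i
  · exact h08.1
  · exact h14.1
  · exact h2
  · exact h3
  · exact h14.2
  · exact h5
  · exact h67.1
  · exact h67.2
  · exact h08.2
  · exact h9
  · exact h10

lemma zline_sub {α : ℂ} (h : zpr α) {i j : Fin 11} (hs : zPL (zcoef α i) ⊆ zPL (zcoef α j)) :
    i = j := by
  by_contra hij
  obtain ⟨m, hm⟩ := zexists_m (zcr_ne h hij)
  obtain ⟨f, -, -, hr⟩ := zparam hm
  have := hr ▸ Set.mem_range_self (f := f) 0
  exact this.2 (hs this.1)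

lemma zcon_pt {α : ℂ} (h : zpr α) {i j : Fin 11} (hij : i ≠ j) (k : Fin 11) :
    zcon i j k = true ↔ ∃ p, p ∈ zPL (zcoef α i) ∧ p ∈ zPL (zcoef α j) ∧ p ∈ zPL (zcoef α k) := by
  rw [zcon_iff h]
  constructor
  · intro h0
    refine ⟨Projectivization.mk ℂ _ (zcr_ne h hij), ?_, ?_, ?_⟩
    · rw [zPL_mk, zlf_l]
    · rw [zPL_mk, zlf_r]
    · rw [zPL_mk, h0]
  · rintro ⟨p, h1, h2, h3⟩
    rw [zinter (zcr_ne h hij) h1 h2, zPL_mk] at h3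
    exact h3

lemma zne_some : ∀ k : Fin 11, ∃ j, k ≠ j := by decide

lemma zlines {α β : ℂ} (hα : zpr α) (hβ : zpr β) (h : CP2 ≃ₜ CP2)
    (hh : h '' (⋃ k, zPL (zcoef α k)) = ⋃ k, zPL (zcoef β k)) :
    ∀ k p, h p ∈ zPL (zcoef β k) ↔ p ∈ zPL (zcoef α k) := by
  have h1 : ∀ k, ∃ m, zPL (zcoef α k) ⊆ h ⁻¹' zPL (zcoef β m) := by
    intro k
    obtain ⟨j, hj⟩ := zne_some k
    apply zcover (zcr_ne hα hj) (fun m => h ⁻¹' zPL (zcoef β m))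
    · intro i; exact (zPL_closed _).preimage h.continuous
    · intro i j hij
      rw [← Set.preimage_inter]
      exact (zinter_fin (zcr_ne hβ hij)).preimage h.injective.injOn
    · rw [← Set.preimage_iUnion, ← hh, h.injective.preimage_image]
      exact Set.subset_iUnion (fun k => zPL (zcoef α k)) k
  have h2 : ∀ m, ∃ k, zPL (zcoef β m) ⊆ h.symm ⁻¹' zPL (zcoef α k) := by
    intro k
    obtain ⟨j, hj⟩ := zne_some k
    apply zcover (zcr_ne hβ hj) (fun m => h.symm ⁻¹' zPL (zcoef α m))
    · intro i; exact (zPL_closed _).preimage h.symm.continuous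
    · intro i j hij
      rw [← Set.preimage_inter]
      exact (zinter_fin (zcr_ne hα hij)).preimage h.symm.injective.injOn
    · rw [← Set.preimage_iUnion, ← h.image_eq_preimage_symm, hh]
      exact Set.subset_iUnion (fun k => zPL (zcoef β k)) k
  choose σ hσ using h1
  choose τ hτ using h2
  have hτσ : ∀ k, τ (σ k) = k := by
    intro k
    symm
    apply zline_sub hα
    intro p hp
    simpa using hτ _ (hσ k hp)
  have hστ : ∀ k, σ (τ k) = k := by
    intro k
    symm
    apply zline_sub hβ
    intro p hp
    simpa using hσ _ (hτ k hp)
  have hmem : ∀ k p, h p ∈ zPL (zcoef β (σ k)) ↔ p ∈ zPL (zcoef α k) := by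
    intro k p
    constructor
    · intro hp
      have := hτ _ hp
      rw [hτσ] at this
      simpa using this
    · intro hp; exact hσ k hp
  let s : Equiv.Perm (Fin 11) := ⟨σ, τ, hτσ, hστ⟩
  have hs : ∀ i, σ i = i := by
    apply zsig_id s
    intro i j k
    by_cases hij : i = j
    · subst hij; rw [zcon_self, zcon_self]
    · rw [Bool.eq_iff_iff, zcon_pt hα hij, zcon_pt hβ (fun h' => hij (s.injective h'))]
      constructor
      · rintro ⟨p, a, b, c⟩
        refine ⟨h.symm p, ?_, ?_, ?_⟩
        · rw [← hmem]; rw [h.apply_symm_apply]; exact a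
        · rw [← hmem]; rw [h.apply_symm_apply]; exact b
        · rw [← hmem]; rw [h.apply_symm_apply]; exact c
      · rintro ⟨p, a, b, c⟩
        exact ⟨h p, (hmem _ _).2 a, (hmem _ _).2 b, (hmem _ _).2 c⟩
  intro k p
  rw [← hmem, hs]

/-- `h` maps the lines `a` to the lines `b`. -/
lemma zwind {a b m a' b' : Fin 3 → ℂ} (hD : zlf m (zcr a b) ≠ 0) (h : CP2 ≃ₜ CP2)
    (ha : ∀ p, h p ∈ zPL a' ↔ p ∈ zPL a) (hb : ∀ p, h p ∈ zPL b' ↔ p ∈ zPL b) :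
    ∃ (w : ℤ) (g : CP2 → ℂ), ContinuousOn g (zPL a ∪ zPL b)ᶜ ∧
      ∀ p, p ∉ zPL a → p ∉ zPL b → zrat a' b' (h p) = zrat a b p ^ w * Complex.exp (g p) := by
  apply ztransfer hD (fun p => zrat a' b' (h p))
  · intro p hp
    apply ContinuousAt.continuousWithinAt
    apply ContinuousAt.comp (g := zrat a' b')
    · apply zrat_contAt
      rw [hb]; exact fun h => hp (Or.inr h)
    · exact h.continuous.continuousAt
  · intro p h1 h2
    rw [← ha] at h1
    rw [← hb] at h2
    exact div_ne_zero h1 h2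

lemma zrat_ne {a b : Fin 3 → ℂ} {p : CP2} (h1 : p ∉ zPL a) (h2 : p ∉ zPL b) : zrat a b p ≠ 0 :=
  div_ne_zero h1 h2

lemma zrat_mul {a b c : Fin 3 → ℂ} {p : CP2} (h2 : p ∉ zPL b) :
    zrat a c p = zrat a b p * zrat b c p := by
  unfold zrat
  have : zlf b p.rep ≠ 0 := h2
  field_simp

lemma zwind_pm {a b m a' b' m' : Fin 3 → ℂ} (hD : zlf m (zcr a b) ≠ 0) (hD' : zlf m' (zcr a' b') ≠ 0)
    (h : CP2 ≃ₜ CP2)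
    (ha : ∀ p, h p ∈ zPL a' ↔ p ∈ zPL a) (hb : ∀ p, h p ∈ zPL b' ↔ p ∈ zPL b)
    (w : ℤ) (g : CP2 → ℂ) (hg : ContinuousOn g (zPL a ∪ zPL b)ᶜ)
    (hw : ∀ p, p ∉ zPL a → p ∉ zPL b → zrat a' b' (h p) = zrat a b p ^ w * Complex.exp (g p)) :
    w = 1 ∨ w = -1 := by
  obtain ⟨w', g', hg', hw'⟩ := zwind hD' h.symm (a' := a) (b' := b)
    (fun p => by rw [← ha]; simp) (fun p => by rw [← hb]; simp)
  have : 1 - w * w' = 0 := by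
    apply zloop hD _ (fun p => w' * g p + g' (h p))
    · apply ContinuousOn.add
      · apply (continuousOn_const.mul hg).mono
        intro p hp hp'
        exact hp (Or.inl hp')
      · apply hg'.comp h.continuous.continuousOn
        rintro p hp (hp' | hp')
        · exact hp (Or.inl (Or.inl ((ha p).1 hp')))
        · exact hp (Or.inl (Or.inr ((hb p).1 hp')))
    · intro p h1 h2 h3 _
      have e1 := hw p h1 h2
      have e2 := hw' (h p) (fun h' => h1 ((ha p).1 h')) (fun h' => h2 ((hb p).1 h'))
      rw [h.symm_apply_apply, e1, mul_zpow, ← zpow_mul, ← Complex.exp_int_mul, mul_assoc,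
        ← Complex.exp_add] at e2
      have hr := zrat_ne h1 h2
      rw [zpow_sub₀ hr, zpow_one, div_eq_iff (zpow_ne_zero _ hr)]
      rw [mul_comm]; exact e2
  exact Int.eq_one_or_neg_one_of_mul_eq_one (v := w') (by linarith)

lemma zwind_eq {a b m a' b' m' : Fin 3 → ℂ} (hD : zlf m (zcr a b) ≠ 0)
    (h : CP2 ≃ₜ CP2)
    (ha : ∀ p, h p ∈ zPL a' ↔ p ∈ zPL a) (hb : ∀ p, h p ∈ zPL b' ↔ p ∈ zPL b)
    (hm : ∀ p, h p ∈ zPL m' ↔ p ∈ zPL m)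
    (w : ℤ) (g : CP2 → ℂ) (hg : ContinuousOn g (zPL a ∪ zPL b)ᶜ)
    (hw : ∀ p, p ∉ zPL a → p ∉ zPL b → zrat a' b' (h p) = zrat a b p ^ w * Complex.exp (g p))
    (w2 : ℤ) (g2 : CP2 → ℂ) (hg2 : ContinuousOn g2 (zPL m ∪ zPL b)ᶜ)
    (hw2 : ∀ p, p ∉ zPL m → p ∉ zPL b → zrat m' b' (h p) = zrat m b p ^ w2 * Complex.exp (g2 p)) :
    w = w2 := by
  have hD3 : zlf b (zcr m a) ≠ 0 := by rwa [zlf_rot']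
  obtain ⟨w3, g3, hg3, hw3⟩ := zwind hD3 h hm ha
  have : w2 - w = 0 := by
    apply zloop hD _ (fun p => g3 p + g p - g2 p)
    · refine ContinuousOn.sub (ContinuousOn.add (hg3.mono ?_) (hg.mono ?_)) (hg2.mono ?_)
      · rintro p hp (h | h)
        · exact hp (Or.inr h)
        · exact hp (Or.inl (Or.inl h))
      · rintro p hp h
        · exact hp (Or.inl h)
      · rintro p hp (h | h)
        · exact hp (Or.inr h)
        · exact hp (Or.inl (Or.inr h))
    · intro p h1 h2 h3 h4
      have e1 := hw p h1 h2
      have e2 := hw2 p h3 h2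
      have e3 := hw3 p h3 h1
      rw [zrat_mul (b := a') (fun h' => h1 ((ha p).1 h')), e1, e3, h4, zrat_mul (a := m) (c := b) h1, h4] at e2
      have hr := zrat_ne h1 h2
      simp only [one_zpow, one_mul] at e2
      rw [zpow_sub₀ hr, Complex.exp_sub, Complex.exp_add]
      have := Complex.exp_ne_zero (g2 p)
      have hr' := zpow_ne_zero w hr
      field_simp
      linear_combination -e2
  linarith

lemma zcon29 : ∀ c : Fin 11, c ≠ 2 → c ≠ 9 → zcon c 9 2 = false := by
  simp only [zconT_eq]; decide +kernel

lemma zcon_false {α : ℂ} (h : zpr α) {i j k : Fin 11} (hc : zcon i j k = false) :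
    zlf (zcoef α k) (zcr (zcoef α i) (zcoef α j)) ≠ 0 := by
  intro h0
  rw [← zcon_iff h, hc] at h0
  exact absurd h0 (by simp)

lemma zglobal {α β : ℂ} (hα : zpr α) (hβ : zpr β) (h : CP2 ≃ₜ CP2)
    (hh : ∀ k p, h p ∈ zPL (zcoef β k) ↔ p ∈ zPL (zcoef α k)) :
    ∃ w : ℤ, (w = 1 ∨ w = -1) ∧ ∃ g : Fin 11 → CP2 → ℂ, ∀ c,
      ContinuousOn (g c) (zPL (zcoef α c) ∪ zPL (zcoef α 9))ᶜ ∧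
      ∀ p, p ∉ zPL (zcoef α c) → p ∉ zPL (zcoef α 9) →
        zrat (zcoef β c) (zcoef β 9) (h p) =
          zrat (zcoef α c) (zcoef α 9) p ^ w * Complex.exp (g c p) := by
  have h290 : zcon 2 9 0 = false := by rw [zconT_eq]; decide +kernel
  obtain ⟨w, g2, hg2, hw2⟩ := zwind (zcon_false hα h290) h (hh 2) (hh 9)
  refine ⟨w, zwind_pm (zcon_false hα h290) (zcon_false hβ h290) h (hh 2) (hh 9) w g2 hg2 hw2, ?_⟩
  have : ∀ c : Fin 11, ∃ g : CP2 → ℂ, ContinuousOn g (zPL (zcoef α c) ∪ zPL (zcoef α 9))ᶜ ∧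
      ∀ p, p ∉ zPL (zcoef α c) → p ∉ zPL (zcoef α 9) →
        zrat (zcoef β c) (zcoef β 9) (h p) =
          zrat (zcoef α c) (zcoef α 9) p ^ w * Complex.exp (g p) := by
    intro c
    by_cases h2 : c = 2
    · subst h2; exact ⟨g2, hg2, hw2⟩
    by_cases h9 : c = 9
    · subst h9
      refine ⟨0, continuousOn_const, ?_⟩
      intro p h1 _
      have h1' : h p ∉ zPL (zcoef β 9) := by rwa [hh]
      rw [show zrat (zcoef β 9) (zcoef β 9) (h p) = 1 from div_self h1',
        show zrat (zcoef α 9) (zcoef α 9) p = 1 from div_self h1]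
      simp
    · have hc := zcon29 c h2 h9
      obtain ⟨wc, gc, hgc, hwc⟩ := zwind (zcon_false hα hc) h (hh c) (hh 9)
      have := zwind_eq (zcon_false hα hc) h (hh c) (hh 9) (hh 2) wc gc hgc hwc w g2 hg2 hw2
      subst this
      exact ⟨gc, hgc, hwc⟩
  choose g hg using this
  exact ⟨g, hg⟩

lemma zkappa {a c d : Fin 3 → ℂ} (had : zcr a d ≠ 0) (h0 : zlf c (zcr a d) = 0) :
    ∃ κ, ∀ p ∈ zPL a, zlf c p.rep = κ * zlf d p.rep := by
  obtain ⟨m, hm⟩ := zexists_m had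
  refine ⟨zlf c (zcr m a) / zlf m (zcr a d), fun p hp => ?_⟩
  have h1 := congrArg (zlf c) (zcramer a d m p.rep)
  have hp : zlf a p.rep = 0 := hp
  rw [zlf_add, zlf_add, zlf_smul, zlf_smul, zlf_smul, zlf_smul, h0, hp] at h1
  field_simp
  linear_combination -h1

def zvalid (L c d : Fin 11) : Bool := L != 9 && L != c && L != d && zcon L d c

lemma zconst {α β : ℂ} (hα : zpr α) (hβ : zpr β) (h : CP2 ≃ₜ CP2)
    (hh : ∀ k p, h p ∈ zPL (zcoef β k) ↔ p ∈ zPL (zcoef α k)) (w : ℤ) (g : Fin 11 → CP2 → ℂ)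
    (hg : ∀ c, ContinuousOn (g c) (zPL (zcoef α c) ∪ zPL (zcoef α 9))ᶜ ∧
      ∀ p, p ∉ zPL (zcoef α c) → p ∉ zPL (zcoef α 9) →
        zrat (zcoef β c) (zcoef β 9) (h p) =
          zrat (zcoef α c) (zcoef α 9) p ^ w * Complex.exp (g c p))
    (L c d : Fin 11) (hv : zvalid L c d = true) :
    ∃ M : ℂ, (∀ p, p ∈ zPL (zcoef α L) → p ∉ zPL (zcoef α c) → p ∉ zPL (zcoef α d) →
      p ∉ zPL (zcoef α 9) → g c p - g d p = M) ∧
      ∀ κ κ', (∀ p ∈ zPL (zcoef α L), zlf (zcoef α c) p.rep = κ * zlf (zcoef α d) p.rep) →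
        (∀ p ∈ zPL (zcoef β L), zlf (zcoef β c) p.rep = κ' * zlf (zcoef β d) p.rep) →
        κ' = κ ^ w * Complex.exp M := by
  simp only [zvalid, Bool.and_eq_true, bne_iff_ne, ne_eq] at hv
  obtain ⟨⟨⟨hL9, hLc⟩, hLd⟩, hcon⟩ := hv
  obtain ⟨κ₀, hκ₀⟩ := zkappa (zcr_ne hα hLd) ((zcon_iff hα _ _ _).1 hcon)
  obtain ⟨κ₁, hκ₁⟩ := zkappa (zcr_ne hβ hLd) ((zcon_iff hβ _ _ _).1 hcon)
  set T : Set CP2 := zPL (zcoef α c) ∪ zPL (zcoef α d) ∪ zPL (zcoef α 9) with hT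
  have hfin : (T ∩ zPL (zcoef α L)).Finite := by
    rw [Set.inter_comm, hT, Set.inter_union_distrib_left, Set.inter_union_distrib_left]
    exact ((zinter_fin (zcr_ne hα hLc)).union (zinter_fin (zcr_ne hα hLd))).union
      (zinter_fin (zcr_ne hα hL9))
  have hconn : IsPreconnected (zPL (zcoef α L) \ T) := by
    apply zlineconn (zcr_ne hα hLd) _ hfin
    intro p hp; exact Or.inl (Or.inr hp.2)
  have key : ∀ κ κ', (∀ p ∈ zPL (zcoef α L), zlf (zcoef α c) p.rep = κ * zlf (zcoef α d) p.rep) →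
        (∀ p ∈ zPL (zcoef β L), zlf (zcoef β c) p.rep = κ' * zlf (zcoef β d) p.rep) →
        ∀ p ∈ zPL (zcoef α L) \ T, κ ≠ 0 ∧ κ' = κ ^ w * Complex.exp (g c p - g d p) := by
    intro κ κ' hκ hκ' p hp
    have hpc : p ∉ zPL (zcoef α c) := fun h => hp.2 (Or.inl (Or.inl h))
    have hpd : p ∉ zPL (zcoef α d) := fun h => hp.2 (Or.inl (Or.inr h))
    have hp9 : p ∉ zPL (zcoef α 9) := fun h => hp.2 (Or.inr h)
    have hpd' : h p ∉ zPL (zcoef β d) := by rwa [hh]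
    have hp9' : h p ∉ zPL (zcoef β 9) := by rwa [hh]
    have e1 : zrat (zcoef α c) (zcoef α 9) p = κ * zrat (zcoef α d) (zcoef α 9) p := by
      unfold zrat; rw [hκ p hp.1]; ring
    have e2 : zrat (zcoef β c) (zcoef β 9) (h p) = κ' * zrat (zcoef β d) (zcoef β 9) (h p) := by
      unfold zrat; rw [hκ' (h p) ((hh _ _).2 hp.1)]; ring
    have hk : κ ≠ 0 := by
      rintro rfl
      rw [zero_mul] at e1
      exact zrat_ne hpc hp9 e1
    refine ⟨hk, ?_⟩
    rw [(hg c).2 p hpc hp9, (hg d).2 p hpd hp9, e1, mul_zpow] at e2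
    have hr := zpow_ne_zero w (zrat_ne hpd hp9)
    have hE := Complex.exp_ne_zero (g d p)
    rw [Complex.exp_sub]
    field_simp
    apply mul_left_cancel₀ hr
    linear_combination -e2
  have hne : (zPL (zcoef α L) \ T).Nonempty := by
    have h1 : (zPL (zcoef α L)).Nonempty :=
      ⟨Projectivization.mk ℂ _ (zcr_ne hα hL9), by rw [zPL_mk, zlf_l]⟩
    obtain ⟨p, hp⟩ := h1
    exact closure_nonempty_iff.mp ⟨p, zdense (zcr_ne hα hL9) hfin hp⟩
  obtain ⟨q, hq⟩ := hne
  refine ⟨g c q - g d q, ?_, ?_⟩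
  · intro p hp hpc hpd hp9
    apply zp_exp_const hconn (f := fun p => g c p - g d p) _ (κ₁ / κ₀ ^ w)
    · intro x hx
      obtain ⟨h0, h1⟩ := key κ₀ κ₁ hκ₀ hκ₁ x hx
      have := zpow_ne_zero w h0
      rw [h1]; field_simp
    · exact ⟨hp, by rintro ((h | h) | h) <;> contradiction⟩
    · exact hq
    · refine ContinuousOn.sub ((hg c).1.mono ?_) ((hg d).1.mono ?_)
      · rintro p hp (h | h)
        · exact hp.2 (Or.inl (Or.inl h))
        · exact hp.2 (Or.inr h)
      · rintro p hp (h | h)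
        · exact hp.2 (Or.inl (Or.inr h))
        · exact hp.2 (Or.inr h)
  · intro κ κ' hκ hκ'
    exact (key κ κ' hκ hκ' q hq).2

/-- point `i ∩ j` can be used to evaluate `M L c d` -/
def zchk (i j L c d : Fin 11) : Bool :=
  i != j && zconT i j L && !zconT i j c && !zconT i j d && !zconT i j 9 &&
    (L != 9 && L != c && L != d && zconT L d c)

lemma zcert (M : Fin 11 → Fin 11 → Fin 11 → ℂ) (G : Fin 11 → Fin 11 → Fin 11 → ℂ)
    (H : ∀ i j L c d, zchk i j L c d = true → M L c d = G i j c - G i j d) :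
    M 3 2 0 - M 5 7 0 - M 2 10 7 + M 7 10 2 = 0 := by
  have r0 : 0 - M 2 6 1 - M 0 10 6 + M 3 10 1 = 0 := by
    linear_combination - H 0 2 2 6 1 (by decide) - H 0 2 0 10 6 (by decide) + H 0 2 3 10 1 (by decide)
  have r1 : 0 - M 6 2 1 - M 0 3 2 + M 10 3 1 = 0 := by
    linear_combination - H 0 6 6 2 1 (by decide) - H 0 6 0 3 2 (by decide) + H 0 6 10 3 1 (by decide)
  have r2 : 0 - M 2 3 0 + M 10 3 1 - M 2 6 1 + M 10 6 0 = 0 := by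
    linear_combination - H 2 7 2 3 0 (by decide) + H 2 7 10 3 1 (by decide) - H 2 7 2 6 1 (by decide) + H 2 7 10 6 0 (by decide)
  have r3 : 0 - M 2 5 1 - M 0 7 5 - M 2 10 7 + M 3 10 1 = 0 := by
    linear_combination - H 0 2 2 5 1 (by decide) - H 0 2 0 7 5 (by decide) - H 0 2 2 10 7 (by decide) + H 0 2 3 10 1 (by decide)
  have r4 : 0 - M 2 4 0 - M 1 9 4 + M 6 9 7 + M 5 7 0 = 0 := by
    linear_combination - H 1 2 2 4 0 (by decide) - H 1 2 1 9 4 (by decide) + H 1 2 6 9 7 (by decide) + H 1 2 5 7 0 (by decide)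
  have r5 : 0 - M 5 7 0 - M 2 10 7 + M 6 10 0 = 0 := by
    linear_combination - H 1 2 5 7 0 (by decide) - H 1 2 2 10 7 (by decide) + H 1 2 6 10 0 (by decide)
  have r6 : 0 - M 5 6 1 - M 7 9 6 + M 0 9 8 + M 7 8 1 = 0 := by
    linear_combination - H 0 5 5 6 1 (by decide) - H 0 5 7 9 6 (by decide) + H 0 5 0 9 8 (by decide) + H 0 5 7 8 1 (by decide)
  have r7 : 0 - M 1 5 2 + M 8 5 3 - M 1 10 3 + M 7 10 2 = 0 := by
    linear_combination - H 1 7 1 5 2 (by decide) + H 1 7 8 5 3 (by decide) - H 1 7 1 10 3 (by decide) + H 1 7 7 10 2 (by decide)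
  have r8 : 0 - M 3 2 0 + M 6 2 1 - M 3 10 1 + M 6 10 0 = 0 := by
    linear_combination - H 3 6 3 2 0 (by decide) + H 3 6 6 2 1 (by decide) - H 3 6 3 10 1 (by decide) + H 3 6 6 10 0 (by decide)
  have r9 : 0 - M 2 3 0 - M 5 8 3 + M 1 8 7 + M 5 7 0 = 0 := by
    linear_combination - H 1 2 2 3 0 (by decide) - H 1 2 5 8 3 (by decide) + H 1 2 1 8 7 (by decide) + H 1 2 5 7 0 (by decide)
  have r10 : 0 - M 2 3 0 - M 1 10 3 + M 2 10 7 + M 5 7 0 = 0 := by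
    linear_combination - H 1 2 2 3 0 (by decide) - H 1 2 1 10 3 (by decide) + H 1 2 2 10 7 (by decide) + H 1 2 5 7 0 (by decide)
  have r11 : 0 - M 0 4 2 - M 10 8 4 - M 0 9 8 + M 6 9 7 + M 10 7 2 = 0 := by
    linear_combination - H 0 6 0 4 2 (by decide) - H 0 6 10 8 4 (by decide) - H 0 6 0 9 8 (by decide) + H 0 6 6 9 7 (by decide) + H 0 6 10 7 2 (by decide)
  have r12 : 0 - M 7 5 0 + M 1 5 2 - M 1 6 2 - M 7 9 6 + M 8 9 0 = 0 := by
    linear_combination - H 1 7 7 5 0 (by decide) + H 1 7 1 5 2 (by decide) - H 1 7 1 6 2 (by decide) - H 1 7 7 9 6 (by decide) + H 1 7 8 9 0 (by decide)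
  have r13 : 0 - M 3 2 0 - M 1 5 2 - M 3 8 5 + M 10 8 4 + M 3 4 0 = 0 := by
    linear_combination - H 1 3 3 2 0 (by decide) - H 1 3 1 5 2 (by decide) - H 1 3 3 8 5 (by decide) + H 1 3 10 8 4 (by decide) + H 1 3 3 4 0 (by decide)
  have r14 : 0 - M 3 2 0 - M 1 6 2 + M 10 6 0 = 0 := by
    linear_combination - H 1 3 3 2 0 (by decide) - H 1 3 1 6 2 (by decide) + H 1 3 10 6 0 (by decide)
  have r15 : 0 - M 3 4 0 - M 8 10 4 + M 3 10 1 - M 8 7 1 + M 5 7 0 = 0 := by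
    linear_combination - H 3 5 3 4 0 (by decide) - H 3 5 8 10 4 (by decide) + H 3 5 3 10 1 (by decide) - H 3 5 8 7 1 (by decide) + H 3 5 5 7 0 (by decide)
  have r16 : 0 - M 5 6 1 - M 0 10 6 + M 7 10 2 - M 0 3 2 - M 5 8 3 + M 7 8 1 = 0 := by
    linear_combination - H 0 5 5 6 1 (by decide) - H 0 5 0 10 6 (by decide) + H 0 5 7 10 2 (by decide) - H 0 5 0 3 2 (by decide) - H 0 5 5 8 3 (by decide) + H 0 5 7 8 1 (by decide)
  have r17 : 0 - M 0 4 2 - M 1 9 4 + M 0 9 8 + M 1 8 7 + M 0 7 5 + M 1 5 2 = 0 := by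
    linear_combination - H 0 1 0 4 2 (by decide) - H 0 1 1 9 4 (by decide) + H 0 1 0 9 8 (by decide) + H 0 1 1 8 7 (by decide) + H 0 1 0 7 5 (by decide) + H 0 1 1 5 2 (by decide)
  have r18 : 0 - M 7 5 0 + M 1 5 2 - M 7 10 2 + M 8 10 4 - M 1 9 4 + M 8 9 0 = 0 := by
    linear_combination - H 1 7 7 5 0 (by decide) + H 1 7 1 5 2 (by decide) - H 1 7 7 10 2 (by decide) + H 1 7 8 10 4 (by decide) - H 1 7 1 9 4 (by decide) + H 1 7 8 9 0 (by decide)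
  have r19 : 0 - M 1 5 2 - M 3 8 5 + M 1 8 7 + M 10 7 2 = 0 := by
    linear_combination - H 1 3 1 5 2 (by decide) - H 1 3 3 8 5 (by decide) + H 1 3 1 8 7 (by decide) + H 1 3 10 7 2 (by decide)
  have r20 : 0 - M 8 7 1 - M 2 10 7 + M 8 10 4 - M 2 3 0 + M 2 4 0 - M 8 5 3 + M 2 5 1 = 0 := by
    linear_combination - H 2 8 8 7 1 (by decide) - H 2 8 2 10 7 (by decide) + H 2 8 8 10 4 (by decide) - H 2 8 2 3 0 (by decide) + H 2 8 2 4 0 (by decide) - H 2 8 8 5 3 (by decide) + H 2 8 2 5 1 (by decide)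
  linear_combination (-2 * r0 - 2 * r1 + 2 * r2 + 1 * r3 + 1 * r4 + 2 * r5 - 2 * r6 + 1 * r7 - 2 * r8 - 2 * r9 - 1 * r10 - 1 * r11 + 2 * r12 - 1 * r13 - 2 * r14 - 1 * r15 + 2 * r16 + 1 * r17 - 2 * r18 + 1 * r19 + 1 * r20) / 5

lemma zfinal {α β : ℂ} (hα : zpr α) (hβ : zpr β) (h : CP2 ≃ₜ CP2)
    (hh : h '' (⋃ k, zPL (zcoef α k)) = ⋃ k, zPL (zcoef β k)) : β = α ∨ β = α⁻¹ := by
  have hl := zlines hα hβ h hh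
  obtain ⟨w, hw, g, hg⟩ := zglobal hα hβ h hl
  have hex : ∀ L c d : Fin 11, ∃ M : ℂ, zvalid L c d = true →
      (∀ p, p ∈ zPL (zcoef α L) → p ∉ zPL (zcoef α c) → p ∉ zPL (zcoef α d) →
      p ∉ zPL (zcoef α 9) → g c p - g d p = M) ∧
      ∀ κ κ', (∀ p ∈ zPL (zcoef α L), zlf (zcoef α c) p.rep = κ * zlf (zcoef α d) p.rep) →
        (∀ p ∈ zPL (zcoef β L), zlf (zcoef β c) p.rep = κ' * zlf (zcoef β d) p.rep) →
        κ' = κ ^ w * Complex.exp M := by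
    intro L c d
    by_cases hv : zvalid L c d = true
    · obtain ⟨M, hM⟩ := zconst hα hβ h hl w g hg L c d hv
      exact ⟨M, fun _ => hM⟩
    · exact ⟨0, fun h => absurd h hv⟩
  choose M hM using hex
  let G : Fin 11 → Fin 11 → Fin 11 → ℂ := fun i j c =>
    if hij : i ≠ j then g c (Projectivization.mk ℂ _ (zcr_ne hα hij)) else 0
  have hx := zcert M G (by
    intro i j L c d hc
    have hc' : i ≠ j ∧ zcon i j L = true ∧ zcon i j c = false ∧ zcon i j d = false ∧
        zcon i j 9 = false ∧ zvalid L c d = true := by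
      simp only [zvalid, zconT_eq]
      simp only [zchk, Bool.and_eq_true, bne_iff_ne, Bool.not_eq_true'] at hc ⊢
      tauto
    obtain ⟨hij, hL, hc1, hd1, h91, hv⟩ := hc'
    simp only [G, dif_pos hij]
    symm
    apply (hM L c d hv).1
    · rw [zPL_mk]; exact (zcon_iff hα _ _ _).1 hL
    · rw [zPL_mk]; exact zcon_false hα hc1
    · rw [zPL_mk]; exact zcon_false hα hd1
    · rw [zPL_mk]; exact zcon_false hα h91)
  have hV : ∀ L c d : Fin 11, (L != 9 && L != c && L != d && zconT L d c) = true →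
      zvalid L c d = true := by
    intro L c d h; rw [zvalid, zconT_eq]; exact h
  have k1 := (hM 3 2 0 (hV _ _ _ (by decide))).2 1 1
    (by intro p hp; simp [zPL, zlf, zcoef, zqcoef, zev] at hp ⊢; linear_combination hp)
    (by intro p hp; simp [zPL, zlf, zcoef, zqcoef, zev] at hp ⊢; linear_combination hp)
  have k2 := (hM 5 7 0 (hV _ _ _ (by decide))).2 (-1) (-1)
    (by intro p hp; simp [zPL, zlf, zcoef, zqcoef, zev] at hp ⊢; linear_combination hp)
    (by intro p hp; simp [zPL, zlf, zcoef, zqcoef, zev] at hp ⊢; linear_combination hp)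
  have k3 := (hM 2 10 7 (hV _ _ _ (by decide))).2 (-1) (-1)
    (by intro p hp; simp [zPL, zlf, zcoef, zqcoef, zev] at hp ⊢; linear_combination α * hp)
    (by intro p hp; simp [zPL, zlf, zcoef, zqcoef, zev] at hp ⊢; linear_combination β * hp)
  have k4 := (hM 7 10 2 (hV _ _ _ (by decide))).2 α β
    (by intro p hp; simp [zPL, zlf, zcoef, zqcoef, zev] at hp ⊢; linear_combination -hp)
    (by intro p hp; simp [zPL, zlf, zcoef, zqcoef, zev] at hp ⊢; linear_combination -hp)
  have hm1 : (-1 : ℂ) ^ w = -1 := by rcases hw with rfl | rfl <;> norm_num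
  rw [hm1] at k2 k3
  rw [one_zpow, one_mul] at k1
  have e2 : Complex.exp (M 5 7 0) = 1 := by linear_combination k2
  have e3 : Complex.exp (M 2 10 7) = 1 := by linear_combination k3
  have e := congrArg Complex.exp hx
  rw [Complex.exp_add, Complex.exp_sub, Complex.exp_sub, ← k1, e2, e3, Complex.exp_zero] at e
  have e4 : Complex.exp (M 7 10 2) = 1 := by simpa using e
  rw [e4, mul_one] at k4
  rcases hw with rfl | rfl
  · left; simpa using k4
  · right; simpa using k4

/-- For `i ≠ j ∈ {1,2,3,4}` with `i + j ≢ 0 (mod 5)`, there is no homeomorphism of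
`ℂℙ²` with `h(Z(B^i)) = Z(B^j)`: `(B^i, B^j)` is a Zariski pair. -/
theorem statement14 (ζ : ℂ) (hζ : ζ^4 + ζ^3 + ζ^2 + ζ + 1 = 0)
    (i j : ℕ) (hi : i ∈ Finset.Icc 1 4) (hj : j ∈ Finset.Icc 1 4)
    (hij : i ≠ j) (hmod : ¬ (5 ∣ i + j)) :
    ¬ ∃ h : CP2 ≃ₜ CP2, h '' (⋃ k, B1line (ζ^i) k) = ⋃ k, B1line (ζ^j) k := by
  rintro ⟨h, hh⟩
  have hp : IsPrimitiveRoot ζ 5 := zpr_prim hζ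
  rw [Finset.mem_Icc] at hi hj
  have hcop : ∀ n, 1 ≤ n → n ≤ 4 → Nat.Coprime n 5 := by
    intro n h1 h2; interval_cases n <;> decide
  have hα := zprim_pr (hp.pow_of_coprime i (hcop i hi.1 hi.2))
  have hβ := zprim_pr (hp.pow_of_coprime j (hcop j hj.1 hj.2))
  simp only [zB1line] at hh
  rcases zfinal hα hβ h hh with h1 | h1
  · exact hij (hp.pow_inj (by omega) (by omega) h1.symm)
  · apply hmod
    rw [← hp.pow_eq_one_iff_dvd, pow_add, h1]
    exact mul_inv_cancel₀ (pow_ne_zero _ (hp.ne_zero (by norm_num)))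
end
end
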